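/- Triviality for guarded TGDs is undecidable: the set of (encodings of) tuples (T, ΣD, ΣQ), where T is a finite set of guarded TGDs and ΣD, ΣQ are finite schemas, such that T is ΣD,ΣQ-trivial, is not computable. -/

import Mathlib

set_option autoImplicit false

/-! ### Terms: constants from 𝐂 (coded `Term.const n`) and nulls from 𝐍 (coded `Term.null n`) -/

inductive Term : Type
  | const : ℕ → Term
  | null  : ℕ → Term
deriving DecidableEq

def Term.isConst : Term → Prop
  | .const _ => True
  | .null _  => False

def termEquiv : Term ≃ ℕ ⊕ ℕ where
  toFun t := match t with
    | .const n => Sum.inl n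
    | .null n  => Sum.inr n
  invFun x := match x with
    | Sum.inl n => .const n
    | Sum.inr n => .null n
  left_inv t := by cases t <;> rfl
  right_inv x := by cases x <;> rfl

instance : Primcodable Term := Primcodable.ofEquiv _ termEquiv

/-! ### Relation symbols (with arity) and schemas -/

structure RelSym : Type where
  name : ℕ
  arity : ℕ
deriving DecidableEq

def relSymEquiv : RelSym ≃ ℕ × ℕ where
  toFun r := (r.name, r.arity)
  invFun p := ⟨p.1, p.2⟩
  left_inv r := rfl
  right_inv p := rfl

instance : Primcodable RelSym := Primcodable.ofEquiv _ relSymEquiv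

/-- A schema is a set of relation symbols. -/
abbrev Schema := Set RelSym

/-! ### Facts, instances, databases -/

structure Fct : Type where
  rel : RelSym
  args : List Term
deriving DecidableEq

def fctEquiv : Fct ≃ RelSym × List Term where
  toFun f := (f.rel, f.args)
  invFun p := ⟨p.1, p.2⟩
  left_inv f := rfl
  right_inv p := rfl

instance : Primcodable Fct := Primcodable.ofEquiv _ fctEquiv

/-- A fact is well-formed if its argument tuple matches the arity of its relation symbol
(arities are ≥ 1). -/
def Fct.wf (f : Fct) : Prop := f.args.length = f.rel.arity ∧ 1 ≤ f.rel.arity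

/-- An instance is a (possibly infinite) set of facts. -/
abbrev Inst := Set Fct

/-- The active domain of an instance. -/
def adom (I : Inst) : Set Term := { t | ∃ f ∈ I, t ∈ f.args }

/-- A database: a finite instance of well-formed facts using only constants from 𝐂. -/
def IsDB (I : Inst) : Prop :=
  I.Finite ∧ ∀ f ∈ I, f.wf ∧ ∀ t ∈ f.args, t.isConst

/-- `I` is a Σ-instance. -/
def InstOver (I : Inst) (S : Schema) : Prop := ∀ f ∈ I, f.rel ∈ S ∧ f.wf

/-- `I` is a Σ-database. -/
def IsDatabase (I : Inst) (S : Schema) : Prop := IsDB I ∧ ∀ f ∈ I, f.rel ∈ S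

/-! ### Homomorphisms -/

def Fct.map (h : Term → Term) (f : Fct) : Fct := ⟨f.rel, f.args.map h⟩

/-- `h` is a Σ-homomorphism from `I` to `J`. -/
def IsHomOn (S : Schema) (h : Term → Term) (I J : Inst) : Prop :=
  ∀ f ∈ I, f.rel ∈ S → f.map h ∈ J

/-- `h` is a homomorphism from `I` to `J` (all relation symbols). -/
def IsFullHom (h : Term → Term) (I J : Inst) : Prop := ∀ f ∈ I, f.map h ∈ J

/-- `h` is database-preserving: it is the identity on all constants from 𝐂. -/
def DBPres (h : Term → Term) : Prop := ∀ n : ℕ, h (Term.const n) = Term.const n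

/-- `I →_Σ J`: there is a database-preserving Σ-homomorphism from `I` to `J`. -/
def HomTo (S : Schema) (I J : Inst) : Prop := ∃ h, DBPres h ∧ IsHomOn S h I J

/-- The induced subinstance of `I` on a set `A` of terms. -/
def restrict (I : Inst) (A : Set Term) : Inst := { f | f ∈ I ∧ ∀ t ∈ f.args, t ∈ A }

/-- `I →ⁿ_Σ J`: every induced subinstance of `I` with at most `n` active-domain elements
admits a database-preserving Σ-homomorphism to `J`. -/
def HomN (S : Schema) (n : ℕ) (I J : Inst) : Prop :=
  ∀ A : Set Term, A ⊆ adom I → A.Finite → A.ncard ≤ n → HomTo S (restrict I A) J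

/-- `I →^lim_Σ J`. -/
def HomLim (S : Schema) (I J : Inst) : Prop := ∀ n : ℕ, 1 ≤ n → HomN S n I J

/-- Homomorphic equivalence of instances. -/
def HomEquiv (I J : Inst) : Prop := (∃ h, IsFullHom h I J) ∧ (∃ h, IsFullHom h J I)

/-! ### Gaifman graph and connectedness -/

def coOccur (I : Inst) (a b : Term) : Prop := ∃ f ∈ I, a ∈ f.args ∧ b ∈ f.args

/-- The Gaifman graph of `I` is connected. -/
def Connected (I : Inst) : Prop :=
  ∀ a ∈ adom I, ∀ b ∈ adom I, Relation.ReflTransGen (coOccur I) a b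

/-- Restriction `I|_Σ` of `I` to the facts using a relation symbol from Σ. -/
def restrS (I : Inst) (S : Schema) : Inst := { f | f ∈ I ∧ f.rel ∈ S }

/-- `I` is Σ-connected. -/
def SConnected (S : Schema) (I : Inst) : Prop := Connected (restrS I S)

/-- `C` is a maximally Σ-connected component of `I`. -/
def MaxConnComp (S : Schema) (I C : Inst) : Prop :=
  C ⊆ restrS I S ∧ Connected C ∧
    ∀ C', C ⊆ C' → C' ⊆ restrS I S → Connected C' → C' = C

/-! ### Conjunctive queries -/

structure Atom : Type where
  rel : RelSym
  args : List ℕ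
deriving DecidableEq

def atomEquiv : Atom ≃ RelSym × List ℕ where
  toFun a := (a.rel, a.args)
  invFun p := ⟨p.1, p.2⟩
  left_inv a := rfl
  right_inv p := rfl

instance : Primcodable Atom := Primcodable.ofEquiv _ atomEquiv

def Atom.wf (a : Atom) : Prop := a.args.length = a.rel.arity ∧ 1 ≤ a.rel.arity

/-- Instantiate an atom by an assignment of terms to variables. -/
def Atom.inst (h : ℕ → Term) (a : Atom) : Fct := ⟨a.rel, a.args.map h⟩

/-- A conjunctive query: a finite set of relational atoms (as a list) together with a
tuple of answer variables. -/
structure CQ : Type where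
  atoms : List Atom
  ans : List ℕ
deriving DecidableEq

def cqEquiv : CQ ≃ List Atom × List ℕ where
  toFun q := (q.atoms, q.ans)
  invFun p := ⟨p.1, p.2⟩
  left_inv q := rfl
  right_inv p := rfl

instance : Primcodable CQ := Primcodable.ofEquiv _ cqEquiv

/-- `q` is a CQ over schema Σ. -/
def CQ.Over (q : CQ) (S : Schema) : Prop := ∀ a ∈ q.atoms, a.rel ∈ S ∧ a.wf

/-- A homomorphism from `q` to `I`. -/
def CQHom (q : CQ) (I : Inst) (h : ℕ → Term) : Prop := ∀ a ∈ q.atoms, a.inst h ∈ I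

/-- `c̄` is an answer to `q` on `I`. -/
def IsAnswer (q : CQ) (I : Inst) (c : List Term) : Prop :=
  (∀ x ∈ c, x ∈ adom I) ∧ ∃ h, CQHom q I h ∧ q.ans.map h = c

/-- The canonical database of a CQ (variables viewed as constants/nulls). -/
def canonDB (q : CQ) : Inst := { f | ∃ a ∈ q.atoms, f = a.inst Term.null }

/-! ### Tuple-generating dependencies -/

/-- A TGD `∀x̄∀ȳ (φ(x̄,ȳ) → ∃z̄ ψ(x̄,z̄))`, with `frontier` the tuple `x̄` of
frontier variables. -/
structure TGD : Type where
  body : List Atom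
  head : List Atom
  frontier : List ℕ
deriving DecidableEq

def tgdEquiv : TGD ≃ List Atom × List Atom × List ℕ where
  toFun t := (t.body, t.head, t.frontier)
  invFun p := ⟨p.1, p.2.1, p.2.2⟩
  left_inv t := rfl
  right_inv p := rfl

instance : Primcodable TGD := Primcodable.ofEquiv _ tgdEquiv

def TGD.bodyVars (t : TGD) : Set ℕ := { x | ∃ a ∈ t.body, x ∈ a.args }
def TGD.headVars (t : TGD) : Set ℕ := { x | ∃ a ∈ t.head, x ∈ a.args }

/-- Well-formedness of a TGD: atoms are well-formed, the frontier variables are distinct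
body variables, and every variable shared by body and head is a frontier variable. -/
def TGD.wf (t : TGD) : Prop :=
  (∀ a ∈ t.body, a.wf) ∧ (∀ a ∈ t.head, a.wf) ∧ t.frontier.Nodup ∧
  (∀ x ∈ t.frontier, x ∈ t.bodyVars) ∧
  (∀ x, x ∈ t.bodyVars → x ∈ t.headVars → x ∈ t.frontier)

/-- A TGD is linear if its body contains at most one atom. -/
def TGD.Linear (t : TGD) : Prop := t.body.length ≤ 1

/-- A TGD is guarded if some body atom contains all body variables. -/
def TGD.Guarded (t : TGD) : Prop := ∃ a ∈ t.body, ∀ x, x ∈ t.bodyVars → x ∈ a.args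

/-- A TGD is frontier-one if it has exactly one frontier variable. -/
def TGD.FrontierOne (t : TGD) : Prop := t.frontier.length = 1

/-- `I ⊨ ϑ`. -/
def TGD.Satisfies (I : Inst) (t : TGD) : Prop :=
  ∀ g : ℕ → Term, (∀ a ∈ t.body, a.inst g ∈ I) →
    ∃ h : ℕ → Term, (∀ a ∈ t.head, a.inst h ∈ I) ∧ ∀ x ∈ t.frontier, h x = g x

/-- `I` is a model of the set `T` of TGDs. -/
def IsModel (I : Inst) (T : List TGD) : Prop := ∀ t ∈ T, TGD.Satisfies I t

/-- Number of (distinct) variables in the body of a TGD. -/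
def TGD.bodyVarList (t : TGD) : List ℕ := ((t.body.map Atom.args).flatten).dedup

/-- The body width of a set of TGDs. -/
def bodyWidth (T : List TGD) : ℕ := (T.map (fun t => t.bodyVarList.length)).foldr max 0

/-! ### The chase -/

/-- `ϑ` is applicable at tuple `c̄` in `I`. -/
def TGD.Applicable (t : TGD) (I : Inst) (c : List Term) : Prop :=
  (∃ g : ℕ → Term, (∀ a ∈ t.body, a.inst g ∈ I) ∧ t.frontier.map g = c) ∧
  ¬ (∃ h : ℕ → Term, (∀ a ∈ t.head, a.inst h ∈ I) ∧ t.frontier.map h = c)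

/-- `J` is the result of applying `ϑ` in `I` at `c̄`: the head is added, with the
existential variables replaced by distinct fresh nulls. -/
def TGD.StepResult (t : TGD) (I : Inst) (c : List Term) (J : Inst) : Prop :=
  ∃ h : ℕ → Term,
    t.frontier.map h = c ∧
    (∀ x, x ∈ t.headVars → x ∉ t.frontier → (¬ (h x).isConst ∧ h x ∉ adom I)) ∧
    (∀ x y, x ∈ t.headVars → y ∈ t.headVars → x ∉ t.frontier → y ∉ t.frontier →
      h x = h y → x = y) ∧
    J = I ∪ { f | ∃ a ∈ t.head, f = a.inst h }

/-- A chase step from `I` to `J` with some TGD of `T`. -/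
def ChaseStep (T : List TGD) (I J : Inst) : Prop :=
  ∃ t ∈ T, ∃ c, t.Applicable I c ∧ t.StepResult I c J

/-- A chase sequence for `I` with `T` (stalling when no TGD is applicable). -/
def IsChaseSeq (T : List TGD) (I : Inst) (f : ℕ → Inst) : Prop :=
  f 0 = I ∧ ∀ i, ChaseStep T (f i) (f (i+1)) ∨ ((¬ ∃ J, ChaseStep T (f i) J) ∧ f (i+1) = f i)

/-- Fairness: every applicable TGD application is eventually performed or becomes
non-applicable. -/
def IsFair (T : List TGD) (f : ℕ → Inst) : Prop :=
  ∀ i, ∀ t ∈ T, ∀ c, TGD.Applicable t (f i) c →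
    ∃ j, i ≤ j ∧
      ((TGD.Applicable t (f j) c ∧ TGD.StepResult t (f j) c (f (j+1))) ∨
        ¬ TGD.Applicable t (f j) c)

/-- `J` is the result of some fair chase sequence for `I` with `T`. -/
def IsChaseResult (T : List TGD) (I J : Inst) : Prop :=
  ∃ f : ℕ → Inst, IsChaseSeq T I f ∧ IsFair T f ∧ J = ⋃ i, f i

/-- `chase T I`: the result of an arbitrary but fixed fair chase sequence for `I` with `T`. -/
noncomputable def chase (T : List TGD) (I : Inst) : Inst :=
  @dite _ (∃ J, IsChaseResult T I J) (Classical.dec _) (fun h => h.choose) (fun _ => I)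

/-! ### Query answering w.r.t. TGDs and conservativity notions -/

/-- `c̄ ∈ q_T(D)`: `c̄` is a tuple over `adom D` and an answer to `q` on `chase T D`. -/
def AnswerWrt (q : CQ) (T : List TGD) (D : Inst) (c : List Term) : Prop :=
  (∀ x ∈ c, x ∈ adom D) ∧ ∃ h, CQHom q (chase T D) h ∧ q.ans.map h = c

/-- `T2` is `ΣD,ΣQ`-hom-conservative over `T1`. -/
def HomConservative (T1 T2 : List TGD) (SD SQ : Schema) : Prop :=
  ∀ D, IsDatabase D SD → HomTo SQ (chase T2 D) (chase T1 D)

/-- `T2` is `ΣD,ΣQ`-CQ-conservative over `T1`. -/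
def CQConservative (T1 T2 : List TGD) (SD SQ : Schema) : Prop :=
  ∀ D, IsDatabase D SD → ∀ q : CQ, CQ.Over q SQ →
    ∀ c, AnswerWrt q T2 D c → AnswerWrt q T1 D c

/-- `T` is `ΣD,ΣQ`-hom-trivial. -/
def HomTrivial (T : List TGD) (SD SQ : Schema) : Prop :=
  ∀ D, IsDatabase D SD → HomTo SQ (chase T D) D

/-- `T` is `ΣD,ΣQ`-CQ-trivial. -/
def CQTrivial (T : List TGD) (SD SQ : Schema) : Prop :=
  ∀ D, IsDatabase D SD → ∀ q : CQ, CQ.Over q SQ →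
    ∀ c, AnswerWrt q T D c → IsAnswer q D c

/-! ### Basic facts about chase sequences -/

theorem ChaseStep.subset {T : List TGD} {I J : Inst} (h : ChaseStep T I J) : I ⊆ J := by
  obtain ⟨t, -, c, -, k, -, -, -, rfl⟩ := h
  exact Set.subset_union_left

theorem ChaseStep.finite {T : List TGD} {I J : Inst} (h : ChaseStep T I J) (hI : I.Finite) :
    J.Finite := by
  obtain ⟨t, -, c, -, k, -, -, -, rfl⟩ := h
  refine hI.union ((t.head.finite_toSet.image (Atom.inst k)).subset ?_)
  rintro f ⟨a, ha, rfl⟩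
  exact ⟨a, ha, rfl⟩

theorem adom_finite {I : Inst} (hI : I.Finite) : (adom I).Finite := by
  refine (hI.biUnion fun f _ => f.args.finite_toSet).subset ?_
  rintro t ⟨f, hf, ht⟩
  exact Set.mem_biUnion hf ht

theorem adom_mono {I J : Inst} (h : I ⊆ J) : adom I ⊆ adom J :=
  fun _ ⟨f, hf, ht⟩ => ⟨f, h hf, ht⟩

theorem exists_null_bound {A : Set Term} (hA : A.Finite) :
    ∃ B : ℕ, ∀ n, B ≤ n → Term.null n ∉ A := by
  have hfin : (Term.null ⁻¹' A).Finite :=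
    hA.preimage (fun _ _ _ _ h => Term.null.inj h)
  obtain ⟨B, hB⟩ := hfin.bddAbove
  exact ⟨B + 1, fun n hn hmem => by have := hB hmem; omega⟩

theorem TGD.Applicable.exists_stepResult {t : TGD} {I : Inst} {c : List Term}
    (hI : I.Finite) (h : t.Applicable I c) : ∃ J, t.StepResult I c J := by
  classical
  obtain ⟨⟨g, -, hg⟩, -⟩ := h
  obtain ⟨B, hB⟩ := exists_null_bound (adom_finite hI)
  refine ⟨_, fun x => if x ∈ t.frontier then g x else Term.null (B + x), ?_, ?_, ?_, rfl⟩
  · rw [← hg]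
    exact List.map_congr_left fun x hx => if_pos hx
  · intro x _ hx
    simp only [hx, if_false]
    exact ⟨id, hB _ (by omega)⟩
  · intro x y _ _ hx hy hxy
    simp only [hx, hy, if_false, Term.null.injEq] at hxy
    omega

theorem IsChaseSeq.monotone {T : List TGD} {I : Inst} {f : ℕ → Inst} (h : IsChaseSeq T I f) :
    Monotone f := by
  refine monotone_nat_of_le_succ fun i => ?_
  rcases h.2 i with hs | ⟨-, hs⟩
  · exact hs.subset
  · exact hs.ge

theorem exists_isChaseResult (T : List TGD) {I : Inst} (hI : I.Finite) :
    ∃ J, IsChaseResult T I J := by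
  classical
  have hstep : ∀ (i : ℕ) (K : Inst), K.Finite → ∃ L : Inst, L.Finite ∧
      (ChaseStep T K L ∨ ((¬ ∃ J, ChaseStep T K J) ∧ L = K)) ∧
      ∀ p : TGD × List Term, Encodable.encode p = i → p.1 ∈ T → p.1.Applicable K p.2 →
        p.1.StepResult K p.2 L := by
    intro i K hK
    by_cases h : ∃ p : TGD × List Term, Encodable.encode p = i ∧ p.1 ∈ T ∧ p.1.Applicable K p.2
    · obtain ⟨p, hp, hT, ha⟩ := h
      obtain ⟨L, hL⟩ := ha.exists_stepResult hK
      have hc : ChaseStep T K L := ⟨p.1, hT, p.2, ha, hL⟩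
      refine ⟨L, hc.finite hK, Or.inl hc, fun q hq _ _ => ?_⟩
      obtain rfl : q = p := Encodable.encode_injective (hq.trans hp.symm)
      exact hL
    · push Not at h
      by_cases hJ : ∃ J, ChaseStep T K J
      · obtain ⟨J, hJ⟩ := hJ
        exact ⟨J, hJ.finite hK, Or.inl hJ, fun p hp hT ha => absurd ha (h p hp hT)⟩
      · exact ⟨K, hK, Or.inr ⟨hJ, rfl⟩, fun p hp hT ha => absurd ha (h p hp hT)⟩
  choose next hfin hnext hsched using hstep
  let F : ℕ → {K : Inst // K.Finite} := fun n =>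
    Nat.rec ⟨I, hI⟩ (fun i K => ⟨next (Nat.unpair i).2 K.1 K.2, hfin _ _ _⟩) n
  refine ⟨_, fun i => (F i).1, ⟨rfl, fun i => hnext _ _ _⟩, ?_, rfl⟩
  intro i t ht c hc
  refine ⟨Nat.pair i (Encodable.encode (t, c)), Nat.left_le_pair _ _, ?_⟩
  refine (em _).imp (fun ha => ⟨ha, ?_⟩) id
  exact hsched _ _ (F _).2 (t, c) (by simp) ht ha

theorem exists_stage_of_forall_mem {f : ℕ → Inst} (hf : Monotone f) (g : ℕ → Term)
    (l : List Atom) (h : ∀ a ∈ l, a.inst g ∈ ⋃ i, f i) : ∃ i, ∀ a ∈ l, a.inst g ∈ f i := by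
  induction l with
  | nil => exact ⟨0, by simp⟩
  | cons b l ih =>
    obtain ⟨i, hi⟩ := ih fun a ha => h a (List.mem_cons_of_mem _ ha)
    obtain ⟨j, hj⟩ := Set.mem_iUnion.1 (h b List.mem_cons_self)
    refine ⟨max i j, fun a ha => ?_⟩
    rcases List.mem_cons.1 ha with rfl | ha
    · exact hf (le_max_right _ _) hj
    · exact hf (le_max_left _ _) (hi a ha)

theorem IsChaseResult.subset {T : List TGD} {I J : Inst} (h : IsChaseResult T I J) : I ⊆ J := by
  obtain ⟨f, hs, -, rfl⟩ := h
  rw [← hs.1]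
  exact Set.subset_iUnion f 0

theorem IsChaseResult.isModel {T : List TGD} {I J : Inst} (h : IsChaseResult T I J) :
    IsModel J T := by
  obtain ⟨f, hs, hfair, rfl⟩ := h
  intro t ht g hg
  have hmono := hs.monotone
  obtain ⟨i, hi⟩ := exists_stage_of_forall_mem hmono g t.body hg
  suffices H : ∃ j, ∃ h : ℕ → Term, (∀ a ∈ t.head, a.inst h ∈ f j) ∧
      t.frontier.map h = t.frontier.map g by
    obtain ⟨j, h, hh, hfr⟩ := H
    exact ⟨h, fun a ha => Set.mem_iUnion.2 ⟨j, hh a ha⟩, List.map_inj_left.1 hfr⟩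
  by_contra hcon
  push Not at hcon
  have happ : ∀ j, i ≤ j → t.Applicable (f j) (t.frontier.map g) := fun j hj =>
    ⟨⟨g, fun a ha => hmono hj (hi a ha), rfl⟩, fun ⟨h, hh, hc⟩ => hcon j h hh hc⟩
  obtain ⟨j, hj, ⟨-, h, hfr, -, -, hJ⟩ | hna⟩ := hfair i t ht _ (happ i le_rfl)
  · refine hcon (j + 1) h (fun a ha => ?_) hfr
    rw [hJ]
    exact Or.inr ⟨a, ha, rfl⟩
  · exact hna (happ j hj)

theorem chase_isChaseResult (T : List TGD) {I : Inst} (hI : I.Finite) :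
    IsChaseResult T I (chase T I) := by
  have h := exists_isChaseResult T hI
  unfold chase
  rw [dif_pos h]
  exact h.choose_spec

/-! ### Universality of the chase -/

theorem ChaseStep.extend_hom {T : List TGD} (hT : ∀ t ∈ T, t.wf) {I J M : Inst}
    (hM : IsModel M T) (hs : ChaseStep T I J) {h : Term → Term} (hp : DBPres h)
    (hh : IsFullHom h I M) :
    ∃ h', DBPres h' ∧ IsFullHom h' J M ∧ ∀ u ∈ adom I, h' u = h u := by
  classical
  obtain ⟨t, ht, c, ⟨⟨g, hg, hgc⟩, -⟩, s, hsc, hfresh, hinj, rfl⟩ := hs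
  obtain ⟨-, -, -, hfb, -⟩ := hT t ht
  have hsg : ∀ x ∈ t.frontier, s x = g x := List.map_inj_left.1 (hsc.trans hgc.symm)
  obtain ⟨k, hk, hkf⟩ := hM t ht (fun x => h (g x)) fun a ha => by
    have := hh _ (hg a ha)
    simpa [Atom.inst, Fct.map, Function.comp_def] using this
  let fresh : Term → ℕ → Prop := fun u x => x ∈ t.headVars ∧ x ∉ t.frontier ∧ s x = u
  let h' : Term → Term := fun u => if hu : ∃ x, fresh u x then k hu.choose else h u
  have hold : ∀ u ∈ adom I, h' u = h u := by
    intro u hu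
    refine dif_neg ?_
    rintro ⟨x, hx, hxf, rfl⟩
    exact (hfresh x hx hxf).2 hu
  have hnew : ∀ x, x ∈ t.headVars → x ∉ t.frontier → h' (s x) = k x := by
    intro x hx hxf
    have hex : ∃ y, fresh (s x) y := ⟨x, hx, hxf, rfl⟩
    have hc := hex.choose_spec
    rw [show h' (s x) = k hex.choose from dif_pos hex,
      hinj _ _ hc.1 hx hc.2.1 hxf hc.2.2]
  refine ⟨h', fun n => ?_, ?_, hold⟩
  · refine (dif_neg ?_).trans (hp n)
    rintro ⟨x, hx, hxf, hxs⟩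
    exact (hfresh x hx hxf).1 (hxs ▸ trivial)
  · rintro f (hf | ⟨a, ha, rfl⟩)
    · have : f.map h' = f.map h := by
        simp only [Fct.map, Fct.mk.injEq, true_and]
        exact List.map_congr_left fun u hu => hold u ⟨f, hf, hu⟩
      rw [this]
      exact hh f hf
    · have : (a.inst s).map h' = a.inst k := by
        simp only [Fct.map, Atom.inst, Fct.mk.injEq, true_and, List.map_map]
        refine List.map_congr_left fun x hx => ?_
        by_cases hxf : x ∈ t.frontier
        · obtain ⟨b, hb, hxb⟩ := hfb x hxf
          rw [Function.comp_apply, hsg x hxf, hkf x hxf]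
          exact hold _ ⟨_, hg b hb, List.mem_map_of_mem hxb⟩
        · exact hnew x ⟨a, ha, hx⟩ hxf
      rw [this]
      exact hk a ha

theorem IsChaseResult.exists_hom {T : List TGD} (hT : ∀ t ∈ T, t.wf) {I J M : Inst}
    (hJ : IsChaseResult T I J) (hM : IsModel M T) (hIM : I ⊆ M) :
    ∃ h, DBPres h ∧ IsFullHom h J M := by
  classical
  obtain ⟨f, hs, -, rfl⟩ := hJ
  have hext : ∀ (i : ℕ) (h : {h : Term → Term // DBPres h ∧ IsFullHom h (f i) M}),
      ∃ h' : {h : Term → Term // DBPres h ∧ IsFullHom h (f (i + 1)) M},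
        ∀ u ∈ adom (f i), h'.1 u = h.1 u := by
    rintro i ⟨h, hp, hh⟩
    rcases hs.2 i with hc | ⟨-, he⟩
    · obtain ⟨h', hp', hh', hu⟩ := hc.extend_hom hT hM hp hh
      exact ⟨⟨h', hp', hh'⟩, hu⟩
    · exact ⟨⟨h, hp, he ▸ hh⟩, fun _ _ => rfl⟩
  choose next hnext using hext
  have h0 : IsFullHom id (f 0) M := by
    intro a ha
    rw [hs.1] at ha
    simpa [Fct.map] using hIM ha
  let H : ∀ i, {h : Term → Term // DBPres h ∧ IsFullHom h (f i) M} := fun n =>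
    Nat.rec ⟨id, fun _ => rfl, h0⟩ next n
  have hmono := hs.monotone
  have hagree : ∀ i j, i ≤ j → ∀ u ∈ adom (f i), (H j).1 u = (H i).1 u := by
    intro i j hij
    induction j, hij using Nat.le_induction with
    | base => exact fun _ _ => rfl
    | succ j hij ih =>
      intro u hu
      exact (hnext j (H j) u (adom_mono (hmono hij) hu)).trans (ih u hu)
  let L : Term → Term := fun u =>
    if hu : ∃ i, u ∈ adom (f i) then (H (Nat.find hu)).1 u else u
  have hL : ∀ i, ∀ u ∈ adom (f i), L u = (H i).1 u := by
    intro i u hu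
    have hex : ∃ i, u ∈ adom (f i) := ⟨i, hu⟩
    rw [show L u = (H (Nat.find hex)).1 u from dif_pos hex]
    exact (hagree _ _ (Nat.find_min' hex hu) u (Nat.find_spec hex)).symm
  refine ⟨L, fun n => ?_, fun a ha => ?_⟩
  · by_cases hu : ∃ i, Term.const n ∈ adom (f i)
    · exact (hL _ _ hu.choose_spec).trans ((H _).2.1 n)
    · exact dif_neg hu
  · obtain ⟨i, hi⟩ := Set.mem_iUnion.1 ha
    have : a.map L = a.map (H i).1 := by
      simp only [Fct.map, Fct.mk.injEq, true_and]
      exact List.map_congr_left fun u hu => hL i u ⟨a, hi, hu⟩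
    rw [this]
    exact (H i).2.2 a hi

/-- To map the chase of a database back into it, it suffices to find a model of `T` that extends
the database without adding facts over the query schema. -/
theorem homTo_chase_of_model {T : List TGD} (hT : ∀ t ∈ T, t.wf) {D M : Inst} {S : Schema}
    (hD : D.Finite) (hM : IsModel M T) (hDM : D ⊆ M) (hMD : ∀ f ∈ M, f.rel ∈ S → f ∈ D) :
    HomTo S (chase T D) D := by
  obtain ⟨h, hp, hh⟩ := (chase_isChaseResult T hD).exists_hom hT hM hDM
  exact ⟨h, hp, fun f hf hfS => hMD _ (hh f hf) hfS⟩

/-! ### Horn programs over the natural numbers viewed as binary trees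

A positive number is viewed as a binary tree node via `z = Nat.pair x y + 1`, and `0` is the leaf.
-/

/-- The tree with the given left and right subtrees. -/
def node (x y : ℕ) : ℕ := Nat.pair x y + 1

theorem node_inj {a b c d : ℕ} : node a b = node c d ↔ a = c ∧ b = d := by
  simp [node, Nat.pair_eq_pair]

theorem node_ne_zero {a b : ℕ} : node a b ≠ 0 := Nat.succ_ne_zero _

theorem zero_ne_node {a b : ℕ} : 0 ≠ node a b := node_ne_zero.symm

/-- The variables available in a Horn rule. -/
abbrev RVar := Fin 12

/-- A ternary predicate applied to variables. -/
abbrev PredAtom := ℕ × RVar × RVar × RVar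

/-- A Horn rule consists of constraints `z = node x y`, constraints `z = 0`, premises, and a
conclusion. -/
abbrev HornRule := List (RVar × RVar × RVar) × List RVar × List PredAtom × PredAtom

namespace HornRule

def nodes (r : HornRule) : List (RVar × RVar × RVar) := r.1
def zeros (r : HornRule) : List RVar := r.2.1
def prems (r : HornRule) : List PredAtom := r.2.2.1
def concl (r : HornRule) : PredAtom := r.2.2.2

end HornRule

/-- The facts derivable by a Horn program. -/
inductive Derives (P : List HornRule) : ℕ → ℕ → ℕ → ℕ → Prop
  | app (r : HornRule) (hr : r ∈ P) (v : RVar → ℕ)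
      (hn : ∀ p ∈ r.nodes, v p.2.2 = node (v p.1) (v p.2.1))
      (hz : ∀ i ∈ r.zeros, v i = 0)
      (hp : ∀ p ∈ r.prems, Derives P p.1 (v p.2.1) (v p.2.2.1) (v p.2.2.2)) :
      Derives P r.concl.1 (v r.concl.2.1) (v r.concl.2.2.1) (v r.concl.2.2.2)

/-! ### Translation of Horn programs to guarded TGDs

The variables `0, 1, 2, 3` of a translated rule stand for the labels left, right and leaf, and
for a sink; the rule variable `i` is represented by `i + 4`. -/

def guardRel : RelSym := ⟨0, 16⟩
def fstRel : RelSym := ⟨1, 3⟩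
def sndRel : RelSym := ⟨2, 3⟩
def elemRel : RelSym := ⟨3, 1⟩
def runRel : RelSym := ⟨4, 2⟩
def treeRel : RelSym := ⟨5, 5⟩
def predRel (k : ℕ) : RelSym := ⟨6 + k, 7⟩

def dataSchema : List RelSym := [guardRel, fstRel, sndRel, elemRel]
def querySchema : List RelSym := [fstRel, sndRel, elemRel]

def RVar.toVar (i : RVar) : ℕ := i.1 + 4

def guardAtom : Atom := ⟨guardRel, List.range 16⟩
def treeAtom (i : RVar) : Atom := ⟨treeRel, [0, 1, 2, 3, RVar.toVar i]⟩
def predAtom (p : PredAtom) : Atom :=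
  ⟨predRel p.1, [0, 1, 2, 3, RVar.toVar p.2.1, RVar.toVar p.2.2.1, RVar.toVar p.2.2.2]⟩

/-- The atoms saying that `z` is a leaf. -/
def leafAtoms (z : RVar) : List Atom :=
  [⟨elemRel, [RVar.toVar z]⟩, ⟨fstRel, [2, RVar.toVar z, 3]⟩, ⟨fstRel, [2, 3, 3]⟩,
    ⟨sndRel, [2, 3, 3]⟩]

/-- The atoms saying that `p.2.2` is the node with children `p.1` and `p.2.1`. -/
def nodeAtoms (p : RVar × RVar × RVar) : List Atom :=
  [⟨elemRel, [RVar.toVar p.2.2]⟩, ⟨fstRel, [0, RVar.toVar p.2.2, RVar.toVar p.1]⟩,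
    ⟨sndRel, [0, RVar.toVar p.2.2, RVar.toVar p.1]⟩,
    ⟨fstRel, [1, RVar.toVar p.2.2, RVar.toVar p.2.1]⟩,
    ⟨sndRel, [1, RVar.toVar p.2.2, RVar.toVar p.2.1]⟩, ⟨sndRel, [2, RVar.toVar p.2.2, 3]⟩]

/-- A TGD without existential variables, guarded by `guardAtom`. -/
def hornTGD (body : List Atom) (head : Atom) : TGD :=
  ⟨guardAtom :: body, [head], List.range 16⟩

def ruleBody (r : HornRule) : List Atom :=
  (List.finRange 12).map treeAtom ++
    (r.nodes.flatMap nodeAtoms ++ (r.zeros.flatMap leafAtoms ++ r.prems.map predAtom))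

def ruleTGD (r : HornRule) : TGD := hornTGD (ruleBody r) (predAtom r.concl)

def leafTGD : TGD := hornTGD (leafAtoms 0) (treeAtom 0)

def nodeTGD : TGD := hornTGD (nodeAtoms (0, 1, 2) ++ [treeAtom 0, treeAtom 1]) (treeAtom 2)

/-- Once the goal predicate is derived, two runs starting from a common element are created. -/
def goalTGD : TGD :=
  ⟨[⟨predRel 1, [0, 1, 2, 3, 4, 5, 6]⟩],
    [⟨elemRel, [7]⟩, ⟨fstRel, [8, 7, 9]⟩, ⟨sndRel, [8, 7, 10]⟩, ⟨runRel, [9, 10]⟩], []⟩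

/-- The two runs continue forever in lockstep. -/
def runTGD : TGD :=
  ⟨[⟨runRel, [0, 1]⟩], [⟨fstRel, [2, 0, 3]⟩, ⟨sndRel, [2, 1, 4]⟩, ⟨runRel, [3, 4]⟩], [0, 1]⟩

def baseTGDs : List TGD := [leafTGD, nodeTGD, goalTGD, runTGD]

/-- The guarded TGDs associated with a Horn program; predicate `1` is the goal. -/
def programTGDs (P : List HornRule) : List TGD := baseTGDs ++ P.map ruleTGD

/-- An atom that may be used in a rule guarded by `guardAtom`. -/
def Atom.Small (a : Atom) : Prop := a.wf ∧ ∀ x ∈ a.args, x < 16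

theorem RVar.toVar_lt (i : RVar) : RVar.toVar i < 16 := by
  have := i.2
  unfold RVar.toVar
  omega

theorem treeAtom_small (i : RVar) : (treeAtom i).Small := by
  simp [treeAtom, Atom.Small, Atom.wf, treeRel, RVar.toVar_lt]

theorem predAtom_small (p : PredAtom) : (predAtom p).Small := by
  simp [predAtom, Atom.Small, Atom.wf, predRel, RVar.toVar_lt]

theorem leafAtoms_small (z : RVar) : ∀ a ∈ leafAtoms z, a.Small := by
  simp [leafAtoms, Atom.Small, Atom.wf, elemRel, fstRel, sndRel, RVar.toVar_lt]

theorem nodeAtoms_small (p : RVar × RVar × RVar) : ∀ a ∈ nodeAtoms p, a.Small := by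
  simp [nodeAtoms, Atom.Small, Atom.wf, elemRel, fstRel, sndRel, RVar.toVar_lt]

theorem ruleBody_small (r : HornRule) : ∀ a ∈ ruleBody r, a.Small := by
  intro a ha
  simp only [ruleBody, List.mem_append, List.mem_map, List.mem_flatMap] at ha
  rcases ha with ⟨i, -, rfl⟩ | ⟨p, -, hp⟩ | ⟨z, -, hz⟩ | ⟨p, -, rfl⟩
  · exact treeAtom_small i
  · exact nodeAtoms_small p a hp
  · exact leafAtoms_small z a hz
  · exact predAtom_small p

theorem hornTGD_wf_guarded {body : List Atom} {head : Atom} (hb : ∀ a ∈ body, a.Small)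
    (hh : head.Small) : (hornTGD body head).wf ∧ (hornTGD body head).Guarded := by
  have hlt : ∀ x, x ∈ (hornTGD body head).bodyVars → x < 16 := by
    rintro x ⟨a, ha, hx⟩
    rcases List.mem_cons.1 ha with rfl | ha
    · exact List.mem_range.1 hx
    · exact (hb a ha).2 x hx
  refine ⟨⟨?_, ?_, List.nodup_range, ?_, ?_⟩, guardAtom, List.mem_cons_self, ?_⟩
  · intro a ha
    rcases List.mem_cons.1 ha with rfl | ha
    · simp [guardAtom, Atom.wf, guardRel]
    · exact (hb a ha).1
  · intro a ha
    rw [List.mem_singleton.1 ha]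
    exact hh.1
  · exact fun x hx => ⟨guardAtom, List.mem_cons_self, hx⟩
  · exact fun x hx _ => List.mem_range.2 (hlt x hx)
  · exact fun x hx => List.mem_range.2 (hlt x hx)

theorem programTGDs_wf_guarded (P : List HornRule) :
    ∀ t ∈ programTGDs P, t.wf ∧ t.Guarded := by
  intro t ht
  simp only [programTGDs, baseTGDs, List.mem_append, List.mem_cons, List.not_mem_nil, or_false,
    List.mem_map] at ht
  rcases ht with (rfl | rfl | rfl | rfl) | ⟨r, -, rfl⟩
  · exact hornTGD_wf_guarded (leafAtoms_small _) (treeAtom_small _)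
  · refine hornTGD_wf_guarded (fun a ha => ?_) (treeAtom_small _)
    simp only [List.mem_append, List.mem_cons, List.not_mem_nil, or_false] at ha
    rcases ha with ha | rfl | rfl
    · exact nodeAtoms_small _ a ha
    · exact treeAtom_small _
    · exact treeAtom_small _
  · refine ⟨⟨?_, ?_, ?_, ?_, ?_⟩, ?_⟩ <;>
      simp [goalTGD, Atom.wf, TGD.bodyVars, TGD.headVars, TGD.Guarded, predRel, elemRel, fstRel,
        sndRel, runRel]
  · refine ⟨⟨?_, ?_, ?_, ?_, ?_⟩, ?_⟩ <;>
      simp [runTGD, Atom.wf, TGD.bodyVars, TGD.headVars, TGD.Guarded, fstRel, sndRel, runRel]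
  · exact hornTGD_wf_guarded (ruleBody_small r) (predAtom_small _)

theorem Atom.inst_congr {a : Atom} {g h : ℕ → Term} (hgh : ∀ x ∈ a.args, g x = h x) :
    a.inst g = a.inst h := by
  simp only [Atom.inst, Fct.mk.injEq, true_and]
  exact List.map_congr_left hgh

theorem satisfies_hornTGD_iff {body : List Atom} {head : Atom} (hh : head.Small) {I : Inst} :
    TGD.Satisfies I (hornTGD body head) ↔
      ∀ g : ℕ → Term, guardAtom.inst g ∈ I → (∀ a ∈ body, a.inst g ∈ I) → head.inst g ∈ I := by
  constructor
  · intro h g hg hb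
    obtain ⟨k, hk, hkg⟩ := h g (List.forall_mem_cons.2 ⟨hg, hb⟩)
    rw [Atom.inst_congr fun x hx => (hkg x (List.mem_range.2 (hh.2 x hx))).symm]
    exact hk head List.mem_cons_self
  · intro h g hg
    rw [hornTGD, List.forall_mem_cons] at hg
    exact ⟨g, List.forall_mem_singleton.2 (h g hg.1 hg.2), fun _ _ => rfl⟩

theorem forall_mem_ruleBody {r : HornRule} {p : Atom → Prop} :
    (∀ a ∈ ruleBody r, p a) ↔
      (∀ i, p (treeAtom i)) ∧ (∀ q ∈ r.nodes, ∀ a ∈ nodeAtoms q, p a) ∧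
        (∀ z ∈ r.zeros, ∀ a ∈ leafAtoms z, p a) ∧ ∀ q ∈ r.prems, p (predAtom q) := by
  constructor
  · intro h
    simp only [ruleBody, List.mem_append, List.mem_map, List.mem_flatMap] at h
    exact ⟨fun i => h _ (Or.inl ⟨i, List.mem_finRange i, rfl⟩),
      fun q hq a ha => h a (Or.inr (Or.inl ⟨q, hq, ha⟩)),
      fun z hz a ha => h a (Or.inr (Or.inr (Or.inl ⟨z, hz, ha⟩))),
      fun q hq => h _ (Or.inr (Or.inr (Or.inr ⟨q, hq, rfl⟩)))⟩
  · rintro ⟨h₁, h₂, h₃, h₄⟩ a ha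
    simp only [ruleBody, List.mem_append, List.mem_map, List.mem_flatMap] at ha
    rcases ha with ⟨i, -, rfl⟩ | ⟨q, hq, ha⟩ | ⟨z, hz, ha⟩ | ⟨q, hq, rfl⟩
    · exact h₁ i
    · exact h₂ q hq a ha
    · exact h₃ z hz a ha
    · exact h₄ q hq

/-! ### Runs and values in a database -/

/-- There is an infinite lockstep run of two heads in `I` starting at `x` and `x'`. -/
def HasRun (I : Inst) (x x' : Term) : Prop :=
  ∃ S : Term → Term → Prop, S x x' ∧ ∀ y y', S y y' → ∃ e z z',
    ⟨fstRel, [e, y, z]⟩ ∈ I ∧ ⟨sndRel, [e, y', z']⟩ ∈ I ∧ S z z'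

theorem HasRun.exists_next {I : Inst} {x x' : Term} (h : HasRun I x x') :
    ∃ e z z', ⟨fstRel, [e, x, z]⟩ ∈ I ∧ ⟨sndRel, [e, x', z']⟩ ∈ I ∧ HasRun I z z' := by
  obtain ⟨S, hS, hnext⟩ := h
  obtain ⟨e, z, z', h₁, h₂, hz⟩ := hnext x x' hS
  exact ⟨e, z, z', h₁, h₂, S, hz, hnext⟩

theorem HasRun.cons {I : Inst} {x x' e z z' : Term} (h₁ : ⟨fstRel, [e, x, z]⟩ ∈ I)
    (h₂ : ⟨sndRel, [e, x', z']⟩ ∈ I) (h : HasRun I z z') : HasRun I x x' := by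
  refine ⟨fun y y' => HasRun I y y' ∨ (y = x ∧ y' = x'), Or.inr ⟨rfl, rfl⟩, ?_⟩
  rintro y y' (hy | ⟨rfl, rfl⟩)
  · obtain ⟨e, z, z', h₁, h₂, hz⟩ := hy.exists_next
    exact ⟨e, z, z', h₁, h₂, Or.inl hz⟩
  · exact ⟨e, z, z', h₁, h₂, Or.inl h⟩

theorem HasRun.of_loop {I : Inst} {f t : Term} (h₁ : ⟨fstRel, [f, t, t]⟩ ∈ I)
    (h₂ : ⟨sndRel, [f, t, t]⟩ ∈ I) : HasRun I t t := by
  refine ⟨fun y y' => y = t ∧ y' = t, ⟨rfl, rfl⟩, ?_⟩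
  rintro y y' ⟨rfl, rfl⟩
  exact ⟨f, _, _, h₁, h₂, rfl, rfl⟩

/-- `n` is a value of the element `x` relative to the labels `l`, `r`, `f` and the sink `t`. -/
inductive HasVal (I : Inst) (l r f t : Term) : Term → ℕ → Prop
  | leaf {x : Term} (hx : ⟨elemRel, [x]⟩ ∈ I) (h : ⟨fstRel, [f, x, t]⟩ ∈ I)
      (h₁ : ⟨fstRel, [f, t, t]⟩ ∈ I) (h₂ : ⟨sndRel, [f, t, t]⟩ ∈ I) : HasVal I l r f t x 0
  | node {x y z : Term} {a b : ℕ} (hz : ⟨elemRel, [z]⟩ ∈ I) (hl : ⟨fstRel, [l, z, x]⟩ ∈ I)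
      (hl' : ⟨sndRel, [l, z, x]⟩ ∈ I) (hr : ⟨fstRel, [r, z, y]⟩ ∈ I)
      (hr' : ⟨sndRel, [r, z, y]⟩ ∈ I) (hf : ⟨sndRel, [f, z, t]⟩ ∈ I)
      (hx : HasVal I l r f t x a) (hy : HasVal I l r f t y b) : HasVal I l r f t z (node a b)

theorem HasVal.hasRun_of_ne {I : Inst} {l r f t x x' : Term} {m n : ℕ}
    (h : HasVal I l r f t x m) (h' : HasVal I l r f t x' n) (hmn : m ≠ n) :
    HasRun I x x' ∨ HasRun I x' x := by
  induction h generalizing x' n with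
  | leaf hx h h₁ h₂ =>
    cases h' with
    | leaf => exact absurd rfl hmn
    | node hz hl hl' hr hr' hf hx hy => exact Or.inl (.cons h hf (.of_loop h₁ h₂))
  | node hz hl hl' hr hr' hf hx hy ihx ihy =>
    cases h' with
    | leaf hx h h₁ h₂ => exact Or.inr (.cons h hf (.of_loop h₁ h₂))
    | @node u v _ c d hz₂ hl₂ hl₂' hr₂ hr₂' hf₂ hu hv =>
      rw [Ne, node_inj, not_and_or] at hmn
      rcases hmn with hne | hne
      · exact (ihx hu hne).imp (.cons hl hl₂') (.cons hl₂ hl')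
      · exact (ihy hv hne).imp (.cons hr hr₂') (.cons hr₂ hr')

theorem HasVal.elem_mem {I : Inst} {l r f t x : Term} {m : ℕ} (h : HasVal I l r f t x m) :
    ⟨elemRel, [x]⟩ ∈ I := by
  cases h <;> assumption

theorem HasVal.unique {I : Inst} (hI : ¬ ∃ x, ⟨elemRel, [x]⟩ ∈ I ∧ HasRun I x x)
    {l r f t x : Term} {m n : ℕ} (h : HasVal I l r f t x m) (h' : HasVal I l r f t x n) :
    m = n := by
  by_contra hmn
  exact hI ⟨x, h.elem_mem, or_self_iff.1 (h.hasRun_of_ne h' hmn)⟩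

/-! ### Databases without the goal, or with a run, can be extended to models -/

/-- The extension of `D` by all derived facts, for databases with a run. -/
def runModel (D : Inst) : Inst :=
  D ∪ {f | f.rel = treeRel ∨ (∃ k, f.rel = predRel k) ∨
    ∃ x x', f = ⟨runRel, [x, x']⟩ ∧ HasRun D x x'}

theorem treeRel_notMem_dataSchema : treeRel ∉ dataSchema := by decide

theorem runRel_notMem_dataSchema : runRel ∉ dataSchema := by decide

theorem predRel_notMem_dataSchema (k : ℕ) : predRel k ∉ dataSchema := by
  simp [predRel, dataSchema, guardRel, fstRel, sndRel, elemRel]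

theorem treeRel_ne_predRel (k : ℕ) : treeRel ≠ predRel k := by
  simp [treeRel, predRel]

theorem runRel_ne_predRel (k : ℕ) : runRel ≠ predRel k := by
  simp [runRel, predRel]

theorem runRel_ne_treeRel : runRel ≠ treeRel := by decide

theorem mem_of_mem_runModel {D : Inst} {f : Fct} (hf : f ∈ runModel D)
    (hS : f.rel ∈ dataSchema) : f ∈ D := by
  rcases hf with hf | hf | ⟨k, hf⟩ | ⟨x, x', rfl, -⟩
  · exact hf
  · exact absurd (hf ▸ hS) treeRel_notMem_dataSchema
  · exact absurd (hf ▸ hS) (predRel_notMem_dataSchema k)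
  · exact absurd hS runRel_notMem_dataSchema

theorem hasRun_of_mem_runModel {D : Inst} (hS : ∀ f ∈ D, f.rel ∈ dataSchema) {x x' : Term}
    (h : ⟨runRel, [x, x']⟩ ∈ runModel D) : HasRun D x x' := by
  rcases h with h | h | ⟨k, h⟩ | ⟨y, y', h, hr⟩
  · exact absurd (hS _ h) runRel_notMem_dataSchema
  · exact absurd h runRel_ne_treeRel
  · exact absurd h (runRel_ne_predRel k)
  · simp only [Fct.mk.injEq, List.cons.injEq, and_true, true_and] at h
    obtain ⟨rfl, rfl⟩ := h
    exact hr

theorem runModel_isModel {D : Inst} (hS : ∀ f ∈ D, f.rel ∈ dataSchema)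
    (hD : ∃ x, ⟨elemRel, [x]⟩ ∈ D ∧ HasRun D x x)
    (P : List HornRule) : IsModel (runModel D) (programTGDs P) := by
  intro t ht
  simp only [programTGDs, baseTGDs, List.mem_append, List.mem_cons, List.not_mem_nil, or_false,
    List.mem_map] at ht
  rcases ht with (rfl | rfl | rfl | rfl) | ⟨r, -, rfl⟩
  · exact (satisfies_hornTGD_iff (treeAtom_small _)).2 fun g _ _ => Or.inr (Or.inl rfl)
  · exact (satisfies_hornTGD_iff (treeAtom_small _)).2 fun g _ _ => Or.inr (Or.inl rfl)
  · intro g _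
    obtain ⟨x, hx, hr⟩ := hD
    obtain ⟨e, z, z', h₁, h₂, hz⟩ := hr.exists_next
    refine ⟨fun n => if n = 7 then x else if n = 8 then e else if n = 9 then z else z', ?_, ?_⟩
    · simpa [goalTGD, Atom.inst] using
        ⟨Or.inl hx, Or.inl h₁, Or.inl h₂, Or.inr (Or.inr (Or.inr ⟨z, z', rfl, hz⟩))⟩
    · simp [goalTGD]
  · intro g hg
    have hmem : (⟨runRel, [g 0, g 1]⟩ : Fct) ∈ runModel D := by simpa [runTGD, Atom.inst] using hg
    obtain ⟨e, z, z', h₁, h₂, hz⟩ := (hasRun_of_mem_runModel hS hmem).exists_next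
    refine ⟨fun n => if n = 0 then g 0 else if n = 1 then g 1 else if n = 2 then e else
      if n = 3 then z else z', ?_, ?_⟩
    · simpa [runTGD, Atom.inst] using
        ⟨Or.inl h₁, Or.inl h₂, Or.inr (Or.inr (Or.inr ⟨z, z', rfl, hz⟩))⟩
    · simp [runTGD]
  · exact (satisfies_hornTGD_iff (predAtom_small _)).2
      fun g _ _ => Or.inr (Or.inr (Or.inl ⟨_, rfl⟩))

/-- The extension of `D` by the facts derived from the values of its elements. -/
def valModel (P : List HornRule) (D : Inst) : Inst :=
  D ∪ {g | (∃ l r f t x a, g = ⟨treeRel, [l, r, f, t, x]⟩ ∧ HasVal D l r f t x a) ∨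
    ∃ k l r f t x y z a b c, g = ⟨predRel k, [l, r, f, t, x, y, z]⟩ ∧ HasVal D l r f t x a ∧
      HasVal D l r f t y b ∧ HasVal D l r f t z c ∧ Derives P k a b c}

theorem mem_of_mem_valModel {P : List HornRule} {D : Inst} {f : Fct} (hf : f ∈ valModel P D)
    (hS : f.rel ∈ dataSchema) : f ∈ D := by
  rcases hf with hf | ⟨_, _, _, _, _, _, rfl, -⟩ | ⟨k, _, _, _, _, _, _, _, _, _, _, rfl, -⟩
  · exact hf
  · exact absurd hS treeRel_notMem_dataSchema
  · exact absurd hS (predRel_notMem_dataSchema k)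

theorem tree_mem_valModel {P : List HornRule} {D : Inst} (hS : ∀ f ∈ D, f.rel ∈ dataSchema)
    {l r f t x : Term} (h : ⟨treeRel, [l, r, f, t, x]⟩ ∈ valModel P D) :
    ∃ a, HasVal D l r f t x a := by
  rcases h with h | ⟨_, _, _, _, _, a, h, hv⟩ | ⟨k, _, _, _, _, _, _, _, _, _, _, h, -⟩
  · exact absurd (hS _ h) treeRel_notMem_dataSchema
  · simp only [Fct.mk.injEq, List.cons.injEq, and_true, true_and] at h
    obtain ⟨rfl, rfl, rfl, rfl, rfl⟩ := h
    exact ⟨a, hv⟩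
  · exact absurd (congrArg Fct.rel h) (treeRel_ne_predRel k)

theorem pred_mem_valModel {P : List HornRule} {D : Inst} (hS : ∀ f ∈ D, f.rel ∈ dataSchema)
    {k : ℕ} {l r f t x y z : Term} (h : ⟨predRel k, [l, r, f, t, x, y, z]⟩ ∈ valModel P D) :
    ∃ a b c, HasVal D l r f t x a ∧ HasVal D l r f t y b ∧ HasVal D l r f t z c ∧
      Derives P k a b c := by
  rcases h with h | ⟨_, _, _, _, _, a, h, hv⟩ | ⟨j, _, _, _, _, _, _, _, a, b, c, h, hv⟩
  · exact absurd (hS _ h) (predRel_notMem_dataSchema k)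
  · exact absurd (congrArg Fct.rel h).symm (treeRel_ne_predRel k)
  · simp only [predRel, Fct.mk.injEq, RelSym.mk.injEq, List.cons.injEq, and_true,
      Nat.add_left_cancel_iff] at h
    obtain ⟨rfl, rfl, rfl, rfl, rfl, rfl, rfl, rfl⟩ := h
    exact ⟨a, b, c, hv⟩

theorem leafAtoms_valModel {P : List HornRule} {D : Inst} {g : ℕ → Term} {i : RVar}
    (h : ∀ a ∈ leafAtoms i, a.inst g ∈ valModel P D) :
    HasVal D (g 0) (g 1) (g 2) (g 3) (g (RVar.toVar i)) 0 := by
  have h' : ∀ a ∈ leafAtoms i, a.inst g ∈ D := fun a ha => mem_of_mem_valModel (h a ha) (by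
    simp only [leafAtoms, List.mem_cons, List.not_mem_nil, or_false] at ha
    rcases ha with rfl | rfl | rfl | rfl <;> simp [Atom.inst, dataSchema])
  simp only [leafAtoms, List.forall_mem_cons, Atom.inst, List.map_cons, List.map_nil] at h'
  exact .leaf h'.1 h'.2.1 h'.2.2.1 h'.2.2.2.1

theorem nodeAtoms_valModel {P : List HornRule} {D : Inst} {g : ℕ → Term}
    {p : RVar × RVar × RVar} (h : ∀ a ∈ nodeAtoms p, a.inst g ∈ valModel P D) {m n : ℕ}
    (hm : HasVal D (g 0) (g 1) (g 2) (g 3) (g (RVar.toVar p.1)) m)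
    (hn : HasVal D (g 0) (g 1) (g 2) (g 3) (g (RVar.toVar p.2.1)) n) :
    HasVal D (g 0) (g 1) (g 2) (g 3) (g (RVar.toVar p.2.2)) (node m n) := by
  have h' : ∀ a ∈ nodeAtoms p, a.inst g ∈ D := fun a ha => mem_of_mem_valModel (h a ha) (by
    simp only [nodeAtoms, List.mem_cons, List.not_mem_nil, or_false] at ha
    rcases ha with rfl | rfl | rfl | rfl | rfl | rfl <;> simp [Atom.inst, dataSchema])
  simp only [nodeAtoms, List.forall_mem_cons, Atom.inst, List.map_cons, List.map_nil] at h'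
  exact .node h'.1 h'.2.1 h'.2.2.1 h'.2.2.2.1 h'.2.2.2.2.1 h'.2.2.2.2.2.1 hm hn

theorem valModel_isModel {D : Inst} (hS : ∀ f ∈ D, f.rel ∈ dataSchema)
    (hD : ¬ ∃ x, ⟨elemRel, [x]⟩ ∈ D ∧ HasRun D x x) {P : List HornRule}
    (hP : ∀ a b c, ¬ Derives P 1 a b c) : IsModel (valModel P D) (programTGDs P) := by
  intro t ht
  simp only [programTGDs, baseTGDs, List.mem_append, List.mem_cons, List.not_mem_nil, or_false,
    List.mem_map] at ht
  rcases ht with (rfl | rfl | rfl | rfl) | ⟨r, hr, rfl⟩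
  · refine (satisfies_hornTGD_iff (treeAtom_small _)).2 fun g _ hb => ?_
    exact Or.inr (Or.inl ⟨_, _, _, _, _, _, rfl, leafAtoms_valModel hb⟩)
  · refine (satisfies_hornTGD_iff (treeAtom_small _)).2 fun g _ hb => ?_
    rw [List.forall_mem_append] at hb
    obtain ⟨m, hm⟩ := tree_mem_valModel hS (hb.2 (treeAtom 0) (by simp))
    obtain ⟨n, hn⟩ := tree_mem_valModel hS (hb.2 (treeAtom 1) (by simp))
    exact Or.inr (Or.inl ⟨_, _, _, _, _, _, rfl, nodeAtoms_valModel hb.1 hm hn⟩)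
  · intro g hg
    obtain ⟨a, b, c, -, -, -, h⟩ := pred_mem_valModel hS (hg _ List.mem_cons_self)
    exact absurd h (hP a b c)
  · intro g hg
    rcases hg _ List.mem_cons_self with h | ⟨_, _, _, _, _, a, h, hv⟩ |
      ⟨j, _, _, _, _, _, _, _, a, b, c, h, hv⟩
    · exact absurd (hS _ h) runRel_notMem_dataSchema
    · exact absurd (congrArg Fct.rel h) runRel_ne_treeRel
    · exact absurd (congrArg Fct.rel h) (runRel_ne_predRel j)
  · refine (satisfies_hornTGD_iff (predAtom_small _)).2 fun g _ hb => ?_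
    obtain ⟨htree, hnode, hleaf, hprem⟩ := forall_mem_ruleBody.1 hb
    choose v hv using fun i => tree_mem_valModel hS (htree i)
    refine Or.inr (Or.inr ⟨_, _, _, _, _, _, _, _, _, _, _, rfl, hv _, hv _, hv _,
      .app r hr v ?_ ?_ ?_⟩)
    · exact fun p hp => (hv _).unique hD (nodeAtoms_valModel (hnode p hp) (hv _) (hv _))
    · exact fun i hi => (hv _).unique hD (leafAtoms_valModel (hleaf i hi))
    · intro p hp
      obtain ⟨a, b, c, ha, hb, hc, h⟩ := pred_mem_valModel hS (hprem p hp)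
      rwa [(hv _).unique hD ha, (hv _).unique hD hb, (hv _).unique hD hc]

theorem homTrivial_of_not_derives {P : List HornRule} (hP : ∀ a b c, ¬ Derives P 1 a b c) :
    HomTrivial (programTGDs P) {s | s ∈ dataSchema} {s | s ∈ querySchema} := by
  rintro D ⟨⟨hfin, -⟩, hS⟩
  have hQ : ∀ s, s ∈ querySchema → s ∈ dataSchema := fun s hs => List.mem_cons_of_mem _ hs
  have hwf : ∀ t ∈ programTGDs P, t.wf := fun t ht => (programTGDs_wf_guarded P t ht).1
  by_cases hD : ∃ x, ⟨elemRel, [x]⟩ ∈ D ∧ HasRun D x x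
  · exact homTo_chase_of_model hwf hfin (runModel_isModel hS hD P) Set.subset_union_left
      fun f hf hfS => mem_of_mem_runModel hf (hQ _ hfS)
  · exact homTo_chase_of_model hwf hfin (valModel_isModel hS hD hP) Set.subset_union_left
      fun f hf hfS => mem_of_mem_valModel hf (hQ _ hfS)

/-! ### A derivation of the goal refutes triviality -/

/-- The constant representing a number. -/
def numTerm (n : ℕ) : Term := Term.const (n + 4)

/-- The assignment of the variables of a translated rule given by one of the rule variables. -/
def ruleAssign (v : RVar → ℕ) (i : ℕ) : Term :=
  if i < 4 then Term.const i else numTerm (v (Fin.ofNat 12 (i - 4)))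

theorem ruleAssign_toVar (v : RVar → ℕ) (i : RVar) :
    ruleAssign v (RVar.toVar i) = numTerm (v i) := by
  simp [ruleAssign, RVar.toVar]

theorem ruleAssign_zero (v : RVar → ℕ) : ruleAssign v 0 = Term.const 0 := rfl
theorem ruleAssign_one (v : RVar → ℕ) : ruleAssign v 1 = Term.const 1 := rfl
theorem ruleAssign_two (v : RVar → ℕ) : ruleAssign v 2 = Term.const 2 := rfl
theorem ruleAssign_three (v : RVar → ℕ) : ruleAssign v 3 = Term.const 3 := rfl

/-- The facts describing the tree coded by a number. -/
def numFacts : ℕ → List Fct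
  | 0 => [⟨elemRel, [numTerm 0]⟩, ⟨fstRel, [.const 2, numTerm 0, .const 3]⟩,
      ⟨fstRel, [.const 2, .const 3, .const 3]⟩, ⟨sndRel, [.const 2, .const 3, .const 3]⟩]
  | n + 1 => [⟨elemRel, [numTerm (n + 1)]⟩,
      ⟨fstRel, [.const 0, numTerm (n + 1), numTerm n.unpair.1]⟩,
      ⟨sndRel, [.const 0, numTerm (n + 1), numTerm n.unpair.1]⟩,
      ⟨fstRel, [.const 1, numTerm (n + 1), numTerm n.unpair.2]⟩,
      ⟨sndRel, [.const 1, numTerm (n + 1), numTerm n.unpair.2]⟩,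
      ⟨sndRel, [.const 2, numTerm (n + 1), .const 3]⟩]

/-- The database of all trees coded by numbers up to `N`. -/
def treeDB (N : ℕ) : Inst :=
  Set.range (fun v : RVar → Fin (N + 1) => guardAtom.inst (ruleAssign fun i => v i)) ∪
    ⋃ n ∈ Set.Iic N, { f | f ∈ numFacts n }

theorem mem_treeDB_of_le {N n : ℕ} (hn : n ≤ N) {f : Fct} (hf : f ∈ numFacts n) : f ∈ treeDB N :=
  Or.inr (Set.mem_biUnion hn hf)

theorem guard_mem_treeDB {N : ℕ} {v : RVar → ℕ} (hv : ∀ i, v i ≤ N) :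
    guardAtom.inst (ruleAssign v) ∈ treeDB N :=
  Or.inl ⟨fun i => ⟨v i, Nat.lt_succ_of_le (hv i)⟩, rfl⟩

theorem treeDB_finite (N : ℕ) : (treeDB N).Finite :=
  (Set.finite_range _).union ((Set.finite_Iic N).biUnion fun _ _ => List.finite_toSet _)

theorem mem_numFacts_of_mem_treeDB {N : ℕ} {f : Fct} (hf : f ∈ treeDB N) (hg : f.rel ≠ guardRel) :
    ∃ n, f ∈ numFacts n := by
  rcases hf with ⟨v, rfl⟩ | hf
  · exact absurd rfl hg
  · simp only [Set.mem_iUnion] at hf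
    obtain ⟨n, -, hn⟩ := hf
    exact ⟨n, hn⟩

theorem numFacts_spec (n : ℕ) : ∀ f ∈ numFacts n,
    (f.wf ∧ ∀ t ∈ f.args, t.isConst) ∧ f.rel ∈ dataSchema := by
  cases n <;>
    simp [numFacts, numTerm, Fct.wf, Term.isConst, elemRel, fstRel, sndRel, dataSchema]

theorem treeDB_isDatabase (N : ℕ) : IsDatabase (treeDB N) { s | s ∈ dataSchema } := by
  have key : ∀ f ∈ treeDB N, (f.wf ∧ ∀ t ∈ f.args, t.isConst) ∧ f.rel ∈ dataSchema := by
    rintro f (⟨v, rfl⟩ | hf)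
    · refine ⟨⟨by simp [Fct.wf, Atom.inst, guardAtom, guardRel], ?_⟩,
        by simp [dataSchema, Atom.inst, guardAtom]⟩
      intro t ht
      obtain ⟨i, -, rfl⟩ := List.mem_map.1 ht
      unfold ruleAssign numTerm
      split <;> trivial
    · simp only [Set.mem_iUnion] at hf
      obtain ⟨n, -, hn⟩ := hf
      exact numFacts_spec n f hn
  exact ⟨⟨treeDB_finite N, fun f hf => (key f hf).1⟩, fun f hf => (key f hf).2⟩

theorem leafAtoms_treeDB {N : ℕ} {v : RVar → ℕ} {z : RVar} (hz : v z = 0) :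
    ∀ a ∈ leafAtoms z, a.inst (ruleAssign v) ∈ treeDB N := by
  intro a ha
  apply mem_treeDB_of_le (Nat.zero_le N)
  simp only [leafAtoms, List.mem_cons, List.not_mem_nil, or_false] at ha
  rcases ha with rfl | rfl | rfl | rfl <;>
    simp [Atom.inst, numFacts, ruleAssign_toVar, ruleAssign_two, ruleAssign_three, hz]

theorem nodeAtoms_treeDB {N : ℕ} {v : RVar → ℕ} (hv : ∀ i, v i ≤ N) {p : RVar × RVar × RVar}
    (hp : v p.2.2 = node (v p.1) (v p.2.1)) :
    ∀ a ∈ nodeAtoms p, a.inst (ruleAssign v) ∈ treeDB N := by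
  intro a ha
  apply mem_treeDB_of_le (hv p.2.2)
  rw [hp]
  simp only [nodeAtoms, List.mem_cons, List.not_mem_nil, or_false] at ha
  rcases ha with rfl | rfl | rfl | rfl | rfl | rfl <;>
    simp [Atom.inst, numFacts, ruleAssign_toVar, ruleAssign_zero, ruleAssign_one, ruleAssign_two,
      ruleAssign_three, hp, node]

theorem fct_treeAtom_inst (v : RVar → ℕ) (i : RVar) :
    (treeAtom i).inst (ruleAssign v) =
      ⟨treeRel, [.const 0, .const 1, .const 2, .const 3, numTerm (v i)]⟩ := by
  simp [Atom.inst, treeAtom, ruleAssign_toVar, ruleAssign_zero, ruleAssign_one, ruleAssign_two,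
    ruleAssign_three]

theorem fct_predAtom_inst (v : RVar → ℕ) (p : PredAtom) :
    (predAtom p).inst (ruleAssign v) =
      ⟨predRel p.1, [.const 0, .const 1, .const 2, .const 3, numTerm (v p.2.1),
        numTerm (v p.2.2.1), numTerm (v p.2.2.2)]⟩ := by
  simp [Atom.inst, predAtom, ruleAssign_toVar, ruleAssign_zero, ruleAssign_one, ruleAssign_two,
    ruleAssign_three]

section Model

variable {P : List HornRule} {N : ℕ} {J : Inst}

theorem tree_mem_of_model (hJ : IsModel J (programTGDs P)) (hD : treeDB N ⊆ J) :
    ∀ n ≤ N, (⟨treeRel, [.const 0, .const 1, .const 2, .const 3, numTerm n]⟩ : Fct) ∈ J := by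
  intro n
  induction n using Nat.strong_induction_on with
  | _ n ih =>
    intro hn
    cases n with
    | zero =>
      have h := (satisfies_hornTGD_iff (treeAtom_small 0)).1
        (hJ leafTGD (by simp [programTGDs, baseTGDs])) (ruleAssign fun _ => 0)
        (hD (guard_mem_treeDB fun _ => Nat.zero_le N)) fun a ha => hD (leafAtoms_treeDB rfl a ha)
      rwa [fct_treeAtom_inst] at h
    | succ k =>
      let v : RVar → ℕ := ![k.unpair.1, k.unpair.2, k + 1, 0, 0, 0, 0, 0, 0, 0, 0, 0]
      have h₁ : k.unpair.1 ≤ k := Nat.unpair_left_le k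
      have h₂ : k.unpair.2 ≤ k := Nat.unpair_right_le k
      have hv : ∀ i, v i ≤ N := by
        intro i
        fin_cases i <;> simp [v] <;> omega
      have h := (satisfies_hornTGD_iff (treeAtom_small 2)).1
        (hJ nodeTGD (by simp [programTGDs, baseTGDs])) (ruleAssign v)
        (hD (guard_mem_treeDB hv)) (fun a ha => ?_)
      · rwa [fct_treeAtom_inst] at h
      · simp only [List.mem_append, List.mem_cons, List.not_mem_nil, or_false] at ha
        rcases ha with ha | rfl | rfl
        · exact hD (nodeAtoms_treeDB hv (by simp [v, node]) a ha)
        · rw [fct_treeAtom_inst]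
          exact ih _ (by simp [v]; omega) (hv 0)
        · rw [fct_treeAtom_inst]
          exact ih _ (by simp [v]; omega) (hv 1)

end Model

theorem exists_bound_of_derives {P : List HornRule} {k a b c : ℕ} (h : Derives P k a b c) :
    ∃ N₀, ∀ N ≥ N₀, ∀ J, treeDB N ⊆ J → IsModel J (programTGDs P) →
      (⟨predRel k, [.const 0, .const 1, .const 2, .const 3, numTerm a, numTerm b,
        numTerm c]⟩ : Fct) ∈ J := by
  induction h with
  | app r hr v hn hz hp ih =>
    choose! M hM using ih
    refine ⟨max (Finset.univ.sup v) (r.prems.toFinset.sup M), fun N hN J hD hJ => ?_⟩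
    have hv : ∀ i, v i ≤ N := fun i =>
      (Finset.le_sup (Finset.mem_univ i)).trans ((le_max_left _ _).trans hN)
    have h := (satisfies_hornTGD_iff (predAtom_small r.concl)).1
      (hJ (ruleTGD r) (List.mem_append_right _ (List.mem_map_of_mem hr))) (ruleAssign v)
      (hD (guard_mem_treeDB hv)) (forall_mem_ruleBody.2 ⟨fun i => ?_,
        fun q hq a ha => hD (nodeAtoms_treeDB hv (hn q hq) a ha),
        fun z h_mem a ha => hD (leafAtoms_treeDB (hz z h_mem) a ha), fun q hq => ?_⟩)
    · rwa [fct_predAtom_inst] at h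
    · rw [fct_treeAtom_inst]
      exact tree_mem_of_model hJ hD _ (hv i)
    · rw [fct_predAtom_inst]
      exact hM q hq N ((Finset.le_sup (f := M) (List.mem_toFinset.2 hq)).trans
        ((le_max_right _ _).trans hN)) J hD hJ

/-- Reading the children of a number in both relations leads to the same smaller number. -/
theorem exists_lt_of_mem_treeDB {N n : ℕ} {e z z' : Term}
    (h₁ : ⟨fstRel, [e, numTerm n, z]⟩ ∈ treeDB N) (h₂ : ⟨sndRel, [e, numTerm n, z']⟩ ∈ treeDB N) :
    ∃ m < n, z = numTerm m ∧ z' = numTerm m := by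
  obtain ⟨i, hi⟩ := mem_numFacts_of_mem_treeDB h₁ (by simp [fstRel, guardRel])
  obtain ⟨j, hj⟩ := mem_numFacts_of_mem_treeDB h₂ (by simp [sndRel, guardRel])
  have hl := fun k => Nat.unpair_left_le k
  have hr := fun k => Nat.unpair_right_le k
  cases i <;> cases j <;>
    simp [numFacts, numTerm, elemRel, fstRel, sndRel] at hi hj
  · grind
  · rcases hi with ⟨rfl, rfl, rfl⟩ | ⟨rfl, rfl, rfl⟩ <;>
    rcases hj with ⟨h, h', rfl⟩ | ⟨h, h', rfl⟩ <;> simp_all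
    · exact ⟨_, hl _, rfl⟩
    · exact ⟨_, hr _, rfl⟩

theorem not_run_of_hom {T : List TGD} (hT : runTGD ∈ T) {N : ℕ} {J : Inst} {h : Term → Term}
    (hJ : IsModel J T) (hh : IsHomOn { s | s ∈ querySchema } h J (treeDB N)) :
    ∀ (n : ℕ) (x x' : Term), h x = numTerm n → h x' = numTerm n → ⟨runRel, [x, x']⟩ ∉ J := by
  intro n
  induction n using Nat.strong_induction_on with
  | _ n ih =>
    intro x x' hx hx' hmem
    obtain ⟨k, hk, hkg⟩ := hJ runTGD hT (fun i => if i = 0 then x else x')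
      (by simpa [runTGD, Atom.inst] using hmem)
    simp only [runTGD, List.forall_mem_cons, Atom.inst, List.map_cons, List.map_nil] at hk hkg
    have hk₀ : k 0 = x := hkg.1
    have hk₁ : k 1 = x' := hkg.2.1
    rw [hk₀, hk₁] at hk
    have h₁ := hh _ hk.1 (by simp [querySchema])
    have h₂ := hh _ hk.2.1 (by simp [querySchema])
    simp only [Fct.map, List.map_cons, List.map_nil, hx, hx'] at h₁ h₂
    obtain ⟨m, hm, hz, hz'⟩ := exists_lt_of_mem_treeDB h₁ h₂
    exact ih m hm _ _ hz hz' hk.2.2.1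

theorem not_homTrivial_of_derives {P : List HornRule} {a b c : ℕ} (hP : Derives P 1 a b c) :
    ¬ HomTrivial (programTGDs P) { s | s ∈ dataSchema } { s | s ∈ querySchema } := by
  intro htriv
  obtain ⟨N, hN⟩ := exists_bound_of_derives hP
  have hJ := chase_isChaseResult (programTGDs P) (treeDB_finite N)
  obtain ⟨h, -, hh⟩ := htriv (treeDB N) (treeDB_isDatabase N)
  have hgoal := hN N le_rfl _ hJ.subset hJ.isModel
  obtain ⟨k, hk, -⟩ := hJ.isModel goalTGD (by simp [programTGDs, baseTGDs])
    (fun i => if i < 4 then Term.const i else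
      if i = 4 then numTerm a else if i = 5 then numTerm b else numTerm c)
    (by simpa [goalTGD, Atom.inst] using hgoal)
  simp only [goalTGD, List.forall_mem_cons, Atom.inst, List.map_cons, List.map_nil] at hk
  have h₀ := hh _ hk.1 (by simp [querySchema])
  have h₁ := hh _ hk.2.1 (by simp [querySchema])
  have h₂ := hh _ hk.2.2.1 (by simp [querySchema])
  simp only [Fct.map, List.map_cons, List.map_nil] at h₀ h₁ h₂
  obtain ⟨n, hn⟩ : ∃ n, h (k 7) = numTerm n := by
    obtain ⟨i, hi⟩ := mem_numFacts_of_mem_treeDB h₀ (by simp [elemRel, guardRel])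
    cases i <;> simp [numFacts, elemRel, fstRel, sndRel] at hi <;> exact ⟨_, hi⟩
  rw [hn] at h₁ h₂
  obtain ⟨m, -, hz, hz'⟩ := exists_lt_of_mem_treeDB h₁ h₂
  exact not_run_of_hom (by simp [programTGDs, baseTGDs]) hJ.isModel hh m _ _ hz hz' hk.2.2.2.1

/-! ### A Horn program evaluating codes of partial recursive functions -/

section Evaluation

open Turing.ToPartrec (Code)

/-- The unary representation of a number as a tree. -/
def numTree : ℕ → ℕ
  | 0 => 0
  | n + 1 => node 0 (numTree n)

def listTree : List ℕ → ℕ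
  | [] => 0
  | n :: l => node (numTree n) (listTree l)

def codeTree : Code → ℕ
  | .zero' => node 0 0
  | .succ => node 1 0
  | .tail => node 2 0
  | .cons f g => node 3 (node (codeTree f) (codeTree g))
  | .comp f g => node 4 (node (codeTree f) (codeTree g))
  | .case f g => node 5 (node (codeTree f) (codeTree g))
  | .fix f => node 6 (codeTree f)

/-- The premise that the variable `3` has value `t`. -/
def tagPrem (t : ℕ) : PredAtom := (t + 2, 3, 3, 3)

/-- The code `c` evaluates to `w` on input `v`. -/
def evalPrem (c v w : RVar) : PredAtom := (0, c, v, w)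

def zeroRule : HornRule := ([(3, 4, 0), (4, 1, 2)], [4], [tagPrem 0], evalPrem 0 1 2)

def succNilRule : HornRule :=
  ([(3, 4, 0), (4, 4, 5), (5, 4, 2)], [4, 1], [tagPrem 1], evalPrem 0 1 2)

def succConsRule : HornRule :=
  ([(3, 4, 0), (6, 7, 1), (4, 6, 5), (5, 4, 2)], [4], [tagPrem 1], evalPrem 0 1 2)

def tailNilRule : HornRule := ([(3, 4, 0)], [4, 1, 2], [tagPrem 2], evalPrem 0 1 2)

def tailConsRule : HornRule := ([(3, 4, 0), (6, 2, 1)], [4], [tagPrem 2], evalPrem 0 1 2)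

def consNilRule : HornRule :=
  ([(5, 6, 7), (3, 7, 0), (4, 9, 2)], [4, 8], [tagPrem 3, evalPrem 5 1 8, evalPrem 6 1 9],
    evalPrem 0 1 2)

def consConsRule : HornRule :=
  ([(5, 6, 7), (3, 7, 0), (10, 11, 8), (10, 9, 2)], [],
    [tagPrem 3, evalPrem 5 1 8, evalPrem 6 1 9], evalPrem 0 1 2)

def compRule : HornRule :=
  ([(5, 6, 7), (3, 7, 0)], [], [tagPrem 4, evalPrem 6 1 8, evalPrem 5 8 2], evalPrem 0 1 2)

def caseNilRule : HornRule :=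
  ([(5, 6, 7), (3, 7, 0)], [1], [tagPrem 5, evalPrem 5 1 2], evalPrem 0 1 2)

def caseZeroRule : HornRule :=
  ([(5, 6, 7), (3, 7, 0), (4, 8, 1)], [4], [tagPrem 5, evalPrem 5 8 2], evalPrem 0 1 2)

def caseSuccRule : HornRule :=
  ([(5, 6, 7), (3, 7, 0), (4, 9, 10), (10, 8, 1), (9, 8, 11)], [4],
    [tagPrem 5, evalPrem 6 11 2], evalPrem 0 1 2)

def fixNilRule : HornRule :=
  ([(3, 5, 0)], [8, 2], [tagPrem 6, evalPrem 5 1 8], evalPrem 0 1 2)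

def fixZeroRule : HornRule :=
  ([(3, 5, 0), (4, 2, 8)], [4], [tagPrem 6, evalPrem 5 1 8], evalPrem 0 1 2)

def fixSuccRule : HornRule :=
  ([(3, 5, 0), (4, 9, 10), (10, 11, 8)], [4], [tagPrem 6, evalPrem 5 1 8, evalPrem 0 11 2],
    evalPrem 0 1 2)

def evalRules : List HornRule :=
  [zeroRule, succNilRule, succConsRule, tailNilRule, tailConsRule, consNilRule, consConsRule,
    compRule, caseNilRule, caseZeroRule, caseSuccRule, fixNilRule, fixZeroRule, fixSuccRule]

/-- The rule defining the predicate `j + 2` to hold for `j` only. -/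
def isRule : ℕ → HornRule
  | 0 => ([], [0], [], (2, 0, 0, 0))
  | j + 1 => ([(1, 2, 0)], [], [(j.unpair.1 + 2, 1, 1, 1), (j.unpair.2 + 2, 2, 2, 2)],
      (j + 3, 0, 0, 0))

/-- The goal: evaluation halts for the code and the input paired in `m`. -/
def goalRule (m : ℕ) : HornRule :=
  ([(0, 1, 3)], [], [evalPrem 0 1 2, tagPrem m], (1, 0, 0, 0))

def evalProgram (m : ℕ) : List HornRule :=
  evalRules ++ ((List.range (m + 10)).map isRule ++ [goalRule m])

theorem Derives.of_rule {P : List HornRule} {r : HornRule} (hr : r ∈ P) (v : RVar → ℕ)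
    {k a b c : ℕ} (hn : ∀ p ∈ r.nodes, v p.2.2 = node (v p.1) (v p.2.1))
    (hz : ∀ i ∈ r.zeros, v i = 0)
    (hp : ∀ p ∈ r.prems, Derives P p.1 (v p.2.1) (v p.2.2.1) (v p.2.2.2))
    (hk : r.concl.1 = k) (ha : v r.concl.2.1 = a) (hb : v r.concl.2.2.1 = b)
    (hc : v r.concl.2.2.2 = c) : Derives P k a b c := by
  subst hk ha hb hc
  exact .app r hr v hn hz hp

theorem derives_is (m : ℕ) : ∀ j < m + 10, Derives (evalProgram m) (j + 2) j j j := by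
  intro j
  induction j using Nat.strong_induction_on with
  | _ j ih =>
    intro hj
    have hmem : isRule j ∈ evalProgram m := by
      simp only [evalProgram, List.mem_append, List.mem_map, List.mem_range]
      exact Or.inr (Or.inl ⟨j, hj, rfl⟩)
    cases j with
    | zero =>
      exact .of_rule hmem (fun _ => 0) (by simp [isRule, HornRule.nodes])
        (by simp) (by simp [isRule, HornRule.prems]) rfl rfl rfl rfl
    | succ j =>
      have h₁ := Nat.unpair_left_le j
      have h₂ := Nat.unpair_right_le j
      refine .of_rule hmem ![j + 1, j.unpair.1, j.unpair.2, 0, 0, 0, 0, 0, 0, 0, 0, 0]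
        (by simp [isRule, HornRule.nodes, node]) (by simp [isRule, HornRule.zeros]) ?_ rfl rfl rfl
        rfl
      simp only [isRule, HornRule.prems, List.forall_mem_cons]
      exact ⟨ih _ (by omega) (by omega), ih _ (by omega) (by omega), by simp⟩

theorem derives_eval {P : List HornRule} (hP : evalRules ⊆ P)
    (ht : ∀ j < 7, Derives P (j + 2) j j j) (c : Code) :
    ∀ v w, w ∈ c.eval v → Derives P 0 (codeTree c) (listTree v) (listTree w) := by
  induction c with
  | zero' =>
    intro v w hw
    obtain rfl : w = 0 :: v := by simpa using hw
    exact .of_rule (r := zeroRule) (hP (by simp [evalRules]))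
      ![node 0 0, listTree v, node 0 (listTree v), 0, 0, 0, 0, 0, 0, 0, 0, 0]
      (by simp [zeroRule, HornRule.nodes]) (by simp [zeroRule, HornRule.zeros])
      (by simpa [zeroRule, HornRule.prems, tagPrem] using ht 0 (by norm_num)) rfl rfl rfl rfl
  | succ =>
    intro v w hw
    obtain rfl : w = [v.headI.succ] := by simpa using hw
    cases v with
    | nil =>
      exact .of_rule (r := succNilRule) (hP (by simp [evalRules]))
        ![node 1 0, 0, node (node 0 0) 0, 1, 0, node 0 0, 0, 0, 0, 0, 0, 0]
        (by simp [succNilRule, HornRule.nodes]) (by simp [succNilRule, HornRule.zeros])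
        (by simpa [succNilRule, HornRule.prems, tagPrem] using ht 1 (by norm_num)) rfl rfl rfl rfl
    | cons n v =>
      exact .of_rule (r := succConsRule) (hP (by simp [evalRules]))
        ![node 1 0, node (numTree n) (listTree v), node (node 0 (numTree n)) 0, 1, 0,
          node 0 (numTree n), numTree n, listTree v, 0, 0, 0, 0]
        (by simp [succConsRule, HornRule.nodes]) (by simp [succConsRule, HornRule.zeros])
        (by simpa [succConsRule, HornRule.prems, tagPrem] using ht 1 (by norm_num)) rfl rfl rfl rfl
  | tail =>
    intro v w hw
    obtain rfl : w = v.tail := by simpa using hw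
    cases v with
    | nil =>
      exact .of_rule (r := tailNilRule) (hP (by simp [evalRules]))
        ![node 2 0, 0, 0, 2, 0, 0, 0, 0, 0, 0, 0, 0]
        (by simp [tailNilRule, HornRule.nodes]) (by simp [tailNilRule, HornRule.zeros])
        (by simpa [tailNilRule, HornRule.prems, tagPrem] using ht 2 (by norm_num)) rfl rfl rfl rfl
    | cons n v =>
      exact .of_rule (r := tailConsRule) (hP (by simp [evalRules]))
        ![node 2 0, node (numTree n) (listTree v), listTree v, 2, 0, 0, numTree n, 0, 0, 0, 0, 0]
        (by simp [tailConsRule, HornRule.nodes]) (by simp [tailConsRule, HornRule.zeros])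
        (by simpa [tailConsRule, HornRule.prems, tagPrem] using ht 2 (by norm_num)) rfl rfl rfl rfl
  | cons f g hf hg =>
    intro v w hw
    simp only [Code.cons_eval, Part.bind_eq_bind, Part.mem_bind_iff, Part.pure_eq_some,
      Part.mem_some_iff] at hw
    obtain ⟨l, hl, l', hl', rfl⟩ := hw
    cases l with
    | nil =>
      refine .of_rule (r := consNilRule) (hP (by simp [evalRules]))
        ![codeTree (.cons f g), listTree v, node 0 (listTree l'), 3, 0, codeTree f, codeTree g,
          node (codeTree f) (codeTree g), 0, listTree l', 0, 0]
        (by simp [consNilRule, HornRule.nodes, codeTree]) (by simp [consNilRule, HornRule.zeros])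
        ?_ rfl rfl rfl rfl
      simp only [consNilRule, HornRule.prems, List.forall_mem_cons]
      exact ⟨ht 3 (by norm_num), hf _ _ hl, hg _ _ hl', by simp⟩
    | cons n l =>
      refine .of_rule (r := consConsRule) (hP (by simp [evalRules]))
        ![codeTree (.cons f g), listTree v, node (numTree n) (listTree l'), 3, 0, codeTree f,
          codeTree g, node (codeTree f) (codeTree g), node (numTree n) (listTree l), listTree l',
          numTree n, listTree l]
        (by simp [consConsRule, HornRule.nodes, codeTree]) (by simp [consConsRule, HornRule.zeros])
        ?_ rfl rfl rfl rfl
      simp only [consConsRule, HornRule.prems, List.forall_mem_cons]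
      exact ⟨ht 3 (by norm_num), hf _ _ hl, hg _ _ hl', by simp⟩
  | comp f g hf hg =>
    intro v w hw
    rw [Code.comp_eval] at hw
    obtain ⟨l, hl, hw⟩ := Part.mem_bind_iff.1 hw
    refine .of_rule (r := compRule) (hP (by simp [evalRules]))
      ![codeTree (.comp f g), listTree v, listTree w, 4, 0, codeTree f, codeTree g,
        node (codeTree f) (codeTree g), listTree l, 0, 0, 0]
      (by simp [compRule, HornRule.nodes, codeTree]) (by simp [compRule, HornRule.zeros])
      ?_ rfl rfl rfl rfl
    simp only [compRule, HornRule.prems, List.forall_mem_cons]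
    exact ⟨ht 4 (by norm_num), hg _ _ hl, hf _ _ hw, by simp⟩
  | case f g hf hg =>
    intro v w hw
    rw [Code.case_eval] at hw
    rcases v with _ | ⟨_ | n, v⟩
    · refine .of_rule (r := caseNilRule) (hP (by simp [evalRules]))
        ![codeTree (.case f g), 0, listTree w, 5, 0, codeTree f, codeTree g,
          node (codeTree f) (codeTree g), 0, 0, 0, 0]
        (by simp [caseNilRule, HornRule.nodes, codeTree]) (by simp [caseNilRule, HornRule.zeros])
        ?_ rfl rfl rfl rfl
      simp only [caseNilRule, HornRule.prems, List.forall_mem_cons]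
      exact ⟨ht 5 (by norm_num), hf _ _ hw, by simp⟩
    · refine .of_rule (r := caseZeroRule) (hP (by simp [evalRules]))
        ![codeTree (.case f g), node 0 (listTree v), listTree w, 5, 0, codeTree f, codeTree g,
          node (codeTree f) (codeTree g), listTree v, 0, 0, 0]
        (by simp [caseZeroRule, HornRule.nodes, codeTree]) (by simp [caseZeroRule, HornRule.zeros])
        ?_ rfl rfl rfl rfl
      simp only [caseZeroRule, HornRule.prems, List.forall_mem_cons]
      exact ⟨ht 5 (by norm_num), hf _ _ hw, by simp⟩
    · refine .of_rule (r := caseSuccRule) (hP (by simp [evalRules]))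
        ![codeTree (.case f g), node (node 0 (numTree n)) (listTree v), listTree w, 5, 0,
          codeTree f, codeTree g, node (codeTree f) (codeTree g), listTree v, numTree n,
          node 0 (numTree n), node (numTree n) (listTree v)]
        (by simp [caseSuccRule, HornRule.nodes, codeTree]) (by simp [caseSuccRule, HornRule.zeros])
        ?_ rfl rfl rfl rfl
      simp only [caseSuccRule, HornRule.prems, List.forall_mem_cons]
      exact ⟨ht 5 (by norm_num), hg _ _ hw, by simp⟩
  | fix f hf =>
    intro v w hw
    rw [Code.fix_eval] at hw
    refine PFun.fixInduction' (C := fun v => Derives P 0 _ (listTree v) (listTree w)) hw ?_ ?_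
    · intro v hv
      simp only [Part.mem_map_iff] at hv
      obtain ⟨l, hl, hw⟩ := hv
      rcases l with _ | ⟨_ | n, l⟩
      · obtain rfl : [] = w := by simpa using hw
        refine .of_rule (r := fixNilRule) (hP (by simp [evalRules]))
          ![codeTree (.fix f), listTree v, 0, 6, 0, codeTree f, 0, 0, 0, 0, 0, 0]
          (by simp [fixNilRule, HornRule.nodes, codeTree]) (by simp [fixNilRule, HornRule.zeros])
          ?_ rfl rfl rfl rfl
        simp only [fixNilRule, HornRule.prems, List.forall_mem_cons]
        exact ⟨ht 6 (by norm_num), hf _ _ hl, by simp⟩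
      · obtain rfl : l = w := by simpa using hw
        refine .of_rule (r := fixZeroRule) (hP (by simp [evalRules]))
          ![codeTree (.fix f), listTree v, listTree l, 6, 0, codeTree f, 0, 0,
            node 0 (listTree l), 0, 0, 0]
          (by simp [fixZeroRule, HornRule.nodes, codeTree]) (by simp [fixZeroRule, HornRule.zeros])
          ?_ rfl rfl rfl rfl
        simp only [fixZeroRule, HornRule.prems, List.forall_mem_cons]
        exact ⟨ht 6 (by norm_num), hf _ _ hl, by simp⟩
      · simp at hw
    · intro v v' _ hv ih
      simp only [Part.mem_map_iff] at hv
      obtain ⟨l, hl, hw⟩ := hv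
      rcases l with _ | ⟨_ | n, l⟩
      · simp at hw
      · simp at hw
      · obtain rfl : l = v' := by simpa using hw
        refine .of_rule (r := fixSuccRule) (hP (by simp [evalRules]))
          ![codeTree (.fix f), listTree v, listTree w, 6, 0, codeTree f, 0, 0,
            node (node 0 (numTree n)) (listTree l), numTree n, node 0 (numTree n), listTree l]
          (by simp [fixSuccRule, HornRule.nodes, codeTree]) (by simp [fixSuccRule, HornRule.zeros])
          ?_ rfl rfl rfl rfl
        simp only [fixSuccRule, HornRule.prems, List.forall_mem_cons]
        exact ⟨ht 6 (by norm_num), hf _ _ hl, ih, by simp⟩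

theorem derives_goal {c : Code} {l w : List ℕ} (h : w ∈ c.eval l) :
    ∃ x y z, Derives (evalProgram (node (codeTree c) (listTree l))) 1 x y z := by
  set m := node (codeTree c) (listTree l) with hm
  refine ⟨_, _, _, .of_rule (r := goalRule m) (by simp [evalProgram])
    ![codeTree c, listTree l, listTree w, m, 0, 0, 0, 0, 0, 0, 0, 0]
    (by simp [goalRule, HornRule.nodes, hm]) (by simp [goalRule, HornRule.zeros]) ?_ rfl rfl rfl
    rfl⟩
  simp only [goalRule, HornRule.prems, List.forall_mem_cons]
  exact ⟨derives_eval (List.subset_append_left _ _)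
    (fun j hj => derives_is m j (by omega)) c l w h, derives_is m m (by omega), by simp⟩

/-- The intended meaning of the predicates of `evalProgram m`. -/
def EvalSem (m : ℕ) : ℕ → ℕ → ℕ → ℕ → Prop
  | 0, x, y, z => ∀ c l, x = codeTree c → y = listTree l → ∃ w, z = listTree w ∧ w ∈ c.eval l
  | 1, _, _, _ => ∃ x y, m = node x y ∧ ∀ c l, x = codeTree c → y = listTree l → (c.eval l).Dom
  | j + 2, x, _, _ => x = j

theorem numTree_eq_zero {n : ℕ} : numTree n = 0 ↔ n = 0 := by
  cases n <;> simp [numTree, node_ne_zero]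

theorem numTree_eq_node {n x y : ℕ} :
    numTree n = node x y ↔ ∃ k, n = k + 1 ∧ x = 0 ∧ y = numTree k := by
  cases n <;> simp [numTree, node_inj, node_ne_zero, eq_comm]

theorem listTree_eq_zero {l : List ℕ} : listTree l = 0 ↔ l = [] := by
  cases l <;> simp [listTree, node_ne_zero]

theorem listTree_eq_node {l : List ℕ} {x y : ℕ} :
    listTree l = node x y ↔ ∃ n l', l = n :: l' ∧ x = numTree n ∧ y = listTree l' := by
  constructor
  · cases l with
    | nil => exact fun h => absurd h zero_ne_node
    | cons n l =>
      intro h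
      exact ⟨n, l, rfl, (node_inj.1 h).1.symm, (node_inj.1 h).2.symm⟩
  · rintro ⟨n, l, rfl, rfl, rfl⟩
    rfl

theorem codeTree_eq_node_zero {c : Code} {x : ℕ} (h : codeTree c = node 0 x) : c = .zero' := by
  cases c <;> simp_all [codeTree, node_inj]

theorem codeTree_eq_node_one {c : Code} {x : ℕ} (h : codeTree c = node 1 x) : c = .succ := by
  cases c <;> simp_all [codeTree, node_inj]

theorem codeTree_eq_node_two {c : Code} {x : ℕ} (h : codeTree c = node 2 x) : c = .tail := by
  cases c <;> simp_all [codeTree, node_inj]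

theorem codeTree_eq_node_three {c : Code} {x y : ℕ} (h : codeTree c = node 3 (node x y)) :
    ∃ f g, c = .cons f g ∧ x = codeTree f ∧ y = codeTree g := by
  cases c <;> simp_all [codeTree, node_inj]

theorem codeTree_eq_node_four {c : Code} {x y : ℕ} (h : codeTree c = node 4 (node x y)) :
    ∃ f g, c = .comp f g ∧ x = codeTree f ∧ y = codeTree g := by
  cases c <;> simp_all [codeTree, node_inj]

theorem codeTree_eq_node_five {c : Code} {x y : ℕ} (h : codeTree c = node 5 (node x y)) :
    ∃ f g, c = .case f g ∧ x = codeTree f ∧ y = codeTree g := by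
  cases c <;> simp_all [codeTree, node_inj]

theorem codeTree_eq_node_six {c : Code} {x : ℕ} (h : codeTree c = node 6 x) :
    ∃ f, c = .fix f ∧ x = codeTree f := by
  cases c <;> simp_all [codeTree, node_inj]

/-- `EvalSem m` is closed under the rule `r`. -/
def RuleSound (m : ℕ) (r : HornRule) : Prop :=
  ∀ v : RVar → ℕ, (∀ p ∈ r.nodes, v p.2.2 = node (v p.1) (v p.2.1)) → (∀ i ∈ r.zeros, v i = 0) →
    (∀ p ∈ r.prems, EvalSem m p.1 (v p.2.1) (v p.2.2.1) (v p.2.2.2)) →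
    EvalSem m r.concl.1 (v r.concl.2.1) (v r.concl.2.2.1) (v r.concl.2.2.2)

theorem zeroRule_sound (m : ℕ) : RuleSound m zeroRule := by
  intro v hn hz hp c l hc hl
  simp only [zeroRule, HornRule.nodes, HornRule.zeros, HornRule.prems, HornRule.concl, tagPrem,
    evalPrem, EvalSem, List.forall_mem_cons, List.not_mem_nil, false_imp_iff, implies_true,
    and_true] at hn hz hp hc hl ⊢
  rw [hn.1, hp] at hc
  obtain rfl := codeTree_eq_node_zero hc.symm
  exact ⟨0 :: l, by rw [hn.2, hz, hl]; rfl, by simp⟩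

theorem succNilRule_sound (m : ℕ) : RuleSound m succNilRule := by
  intro v hn hz hp c l hc hl
  simp only [succNilRule, HornRule.nodes, HornRule.zeros, HornRule.prems, HornRule.concl, tagPrem,
    evalPrem, EvalSem, List.forall_mem_cons, List.not_mem_nil, false_imp_iff, implies_true,
    and_true] at hn hz hp hc hl ⊢
  rw [hn.1, hp] at hc
  obtain rfl := codeTree_eq_node_one hc.symm
  obtain rfl := listTree_eq_zero.1 (hl.symm.trans hz.2)
  exact ⟨[1], by rw [hn.2.2, hn.2.1, hz.1]; rfl, by simp⟩

theorem succConsRule_sound (m : ℕ) : RuleSound m succConsRule := by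
  intro v hn hz hp c l hc hl
  simp only [succConsRule, HornRule.nodes, HornRule.zeros, HornRule.prems, HornRule.concl, tagPrem,
    evalPrem, EvalSem, List.forall_mem_cons, List.not_mem_nil, false_imp_iff, implies_true,
    and_true] at hn hz hp hc hl ⊢
  rw [hn.1, hp] at hc
  obtain rfl := codeTree_eq_node_one hc.symm
  obtain ⟨n, l, rfl, hx, -⟩ := listTree_eq_node.1 (hl.symm.trans hn.2.1)
  exact ⟨[n + 1], by rw [hn.2.2.2, hn.2.2.1, hz, hx]; rfl, by simp⟩

theorem tailNilRule_sound (m : ℕ) : RuleSound m tailNilRule := by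
  intro v hn hz hp c l hc hl
  simp only [tailNilRule, HornRule.nodes, HornRule.zeros, HornRule.prems, HornRule.concl, tagPrem,
    evalPrem, EvalSem, List.forall_mem_cons, List.not_mem_nil, false_imp_iff, implies_true,
    and_true] at hn hz hp hc hl ⊢
  rw [hn, hp] at hc
  obtain rfl := codeTree_eq_node_two hc.symm
  obtain rfl := listTree_eq_zero.1 (hl.symm.trans hz.2.1)
  exact ⟨[], hz.2.2, by simp⟩

theorem tailConsRule_sound (m : ℕ) : RuleSound m tailConsRule := by
  intro v hn hz hp c l hc hl
  simp only [tailConsRule, HornRule.nodes, HornRule.zeros, HornRule.prems, HornRule.concl, tagPrem,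
    evalPrem, EvalSem, List.forall_mem_cons, List.not_mem_nil, false_imp_iff, implies_true,
    and_true] at hn hz hp hc hl ⊢
  rw [hn.1, hp] at hc
  obtain rfl := codeTree_eq_node_two hc.symm
  obtain ⟨n, l, rfl, -, hx⟩ := listTree_eq_node.1 (hl.symm.trans hn.2)
  exact ⟨l, hx, by simp⟩

theorem consNilRule_sound (m : ℕ) : RuleSound m consNilRule := by
  intro v hn hz hp c l hc hl
  simp only [consNilRule, HornRule.nodes, HornRule.zeros, HornRule.prems, HornRule.concl, tagPrem,
    evalPrem, EvalSem, List.forall_mem_cons, List.not_mem_nil, false_imp_iff, implies_true,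
    and_true] at hn hz hp hc hl ⊢
  obtain ⟨htag, hf, hg⟩ := hp
  rw [hn.2.1, htag, hn.1] at hc
  obtain ⟨f, g, rfl, hxf, hxg⟩ := codeTree_eq_node_three hc.symm
  obtain ⟨w, hw, hwf⟩ := hf f l hxf hl
  obtain ⟨w', hw', hwg⟩ := hg g l hxg hl
  obtain rfl := listTree_eq_zero.1 (hw.symm.trans hz.2)
  refine ⟨0 :: w', by rw [hn.2.2, hz.1, hw']; rfl, ?_⟩
  rw [Code.cons_eval]
  exact Part.mem_bind hwf (Part.mem_bind hwg (Part.mem_some _))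

theorem consConsRule_sound (m : ℕ) : RuleSound m consConsRule := by
  intro v hn hz hp c l hc hl
  simp only [consConsRule, HornRule.nodes, HornRule.zeros, HornRule.prems, HornRule.concl, tagPrem,
    evalPrem, EvalSem, List.forall_mem_cons, List.not_mem_nil, false_imp_iff, implies_true,
    and_true] at hn hz hp hc hl ⊢
  obtain ⟨htag, hf, hg⟩ := hp
  rw [hn.2.1, htag, hn.1] at hc
  obtain ⟨f, g, rfl, hxf, hxg⟩ := codeTree_eq_node_three hc.symm
  obtain ⟨w, hw, hwf⟩ := hf f l hxf hl
  obtain ⟨w', hw', hwg⟩ := hg g l hxg hl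
  obtain ⟨n, w, rfl, hxn, -⟩ := listTree_eq_node.1 (hw.symm.trans hn.2.2.1)
  refine ⟨n :: w', by rw [hn.2.2.2, hxn, hw']; rfl, ?_⟩
  rw [Code.cons_eval]
  exact Part.mem_bind hwf (Part.mem_bind hwg (Part.mem_some _))

theorem compRule_sound (m : ℕ) : RuleSound m compRule := by
  intro v hn hz hp c l hc hl
  simp only [compRule, HornRule.nodes, HornRule.zeros, HornRule.prems, HornRule.concl, tagPrem,
    evalPrem, EvalSem, List.forall_mem_cons, List.not_mem_nil, false_imp_iff, implies_true,
    and_true] at hn hz hp hc hl ⊢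
  obtain ⟨htag, hg, hf⟩ := hp
  rw [hn.2, htag, hn.1] at hc
  obtain ⟨f, g, rfl, hxf, hxg⟩ := codeTree_eq_node_four hc.symm
  obtain ⟨w, hw, hwg⟩ := hg g l hxg hl
  obtain ⟨w', hw', hwf⟩ := hf f w hxf hw
  refine ⟨w', hw', ?_⟩
  rw [Code.comp_eval]
  exact Part.mem_bind hwg hwf

theorem caseNilRule_sound (m : ℕ) : RuleSound m caseNilRule := by
  intro v hn hz hp c l hc hl
  simp only [caseNilRule, HornRule.nodes, HornRule.zeros, HornRule.prems, HornRule.concl, tagPrem,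
    evalPrem, EvalSem, List.forall_mem_cons, List.not_mem_nil, false_imp_iff, implies_true,
    and_true] at hn hz hp hc hl ⊢
  obtain ⟨htag, hf⟩ := hp
  rw [hn.2, htag, hn.1] at hc
  obtain ⟨f, g, rfl, hxf, -⟩ := codeTree_eq_node_five hc.symm
  obtain ⟨w, hw, hwf⟩ := hf f l hxf hl
  obtain rfl := listTree_eq_zero.1 (hl.symm.trans hz)
  refine ⟨w, hw, ?_⟩
  rw [Code.case_eval]
  exact hwf

theorem caseZeroRule_sound (m : ℕ) : RuleSound m caseZeroRule := by
  intro v hn hz hp c l hc hl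
  simp only [caseZeroRule, HornRule.nodes, HornRule.zeros, HornRule.prems, HornRule.concl, tagPrem,
    evalPrem, EvalSem, List.forall_mem_cons, List.not_mem_nil, false_imp_iff, implies_true,
    and_true] at hn hz hp hc hl ⊢
  obtain ⟨htag, hf⟩ := hp
  rw [hn.2.1, htag, hn.1] at hc
  obtain ⟨f, g, rfl, hxf, -⟩ := codeTree_eq_node_five hc.symm
  obtain ⟨n, l, rfl, hxn, hxl⟩ := listTree_eq_node.1 (hl.symm.trans hn.2.2)
  obtain rfl := numTree_eq_zero.1 (hxn.symm.trans hz)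
  obtain ⟨w, hw, hwf⟩ := hf f l hxf hxl
  refine ⟨w, hw, ?_⟩
  rw [Code.case_eval]
  exact hwf

theorem caseSuccRule_sound (m : ℕ) : RuleSound m caseSuccRule := by
  intro v hn hz hp c l hc hl
  simp only [caseSuccRule, HornRule.nodes, HornRule.zeros, HornRule.prems, HornRule.concl, tagPrem,
    evalPrem, EvalSem, List.forall_mem_cons, List.not_mem_nil, false_imp_iff, implies_true,
    and_true] at hn hz hp hc hl ⊢
  obtain ⟨htag, hg⟩ := hp
  rw [hn.2.1, htag, hn.1] at hc
  obtain ⟨f, g, rfl, -, hxg⟩ := codeTree_eq_node_five hc.symm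
  obtain ⟨n, l, rfl, hxn, hxl⟩ := listTree_eq_node.1 (hl.symm.trans hn.2.2.2.1)
  obtain ⟨n, rfl, -, hxn⟩ := numTree_eq_node.1 (hxn.symm.trans hn.2.2.1)
  obtain ⟨w, hw, hwg⟩ := hg g (n :: l) hxg (by rw [hn.2.2.2.2, hxn, hxl]; rfl)
  refine ⟨w, hw, ?_⟩
  rw [Code.case_eval]
  exact hwg

theorem fixNilRule_sound (m : ℕ) : RuleSound m fixNilRule := by
  intro v hn hz hp c l hc hl
  simp only [fixNilRule, HornRule.nodes, HornRule.zeros, HornRule.prems, HornRule.concl, tagPrem,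
    evalPrem, EvalSem, List.forall_mem_cons, List.not_mem_nil, false_imp_iff, implies_true,
    and_true] at hn hz hp hc hl ⊢
  obtain ⟨htag, hf⟩ := hp
  rw [hn, htag] at hc
  obtain ⟨f, rfl, hxf⟩ := codeTree_eq_node_six hc.symm
  obtain ⟨w, hw, hwf⟩ := hf f l hxf hl
  obtain rfl := listTree_eq_zero.1 (hw.symm.trans hz.1)
  refine ⟨[], hz.2, ?_⟩
  rw [Code.fix_eval]
  exact PFun.mem_fix_iff.2 (Or.inl (Part.mem_map _ hwf))

theorem fixZeroRule_sound (m : ℕ) : RuleSound m fixZeroRule := by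
  intro v hn hz hp c l hc hl
  simp only [fixZeroRule, HornRule.nodes, HornRule.zeros, HornRule.prems, HornRule.concl, tagPrem,
    evalPrem, EvalSem, List.forall_mem_cons, List.not_mem_nil, false_imp_iff, implies_true,
    and_true] at hn hz hp hc hl ⊢
  obtain ⟨htag, hf⟩ := hp
  rw [hn.1, htag] at hc
  obtain ⟨f, rfl, hxf⟩ := codeTree_eq_node_six hc.symm
  obtain ⟨w, hw, hwf⟩ := hf f l hxf hl
  obtain ⟨n, w, rfl, hxn, hxw⟩ := listTree_eq_node.1 (hw.symm.trans hn.2)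
  obtain rfl := numTree_eq_zero.1 (hxn.symm.trans hz)
  refine ⟨w, hxw, ?_⟩
  rw [Code.fix_eval]
  exact PFun.mem_fix_iff.2 (Or.inl (Part.mem_map _ hwf))

theorem fixSuccRule_sound (m : ℕ) : RuleSound m fixSuccRule := by
  intro v hn hz hp c l hc hl
  simp only [fixSuccRule, HornRule.nodes, HornRule.zeros, HornRule.prems, HornRule.concl, tagPrem,
    evalPrem, EvalSem, List.forall_mem_cons, List.not_mem_nil, false_imp_iff, implies_true,
    and_true] at hn hz hp hc hl ⊢
  obtain ⟨htag, hf, hfix⟩ := hp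
  have hc' := hc
  rw [hn.1, htag] at hc
  obtain ⟨f, rfl, hxf⟩ := codeTree_eq_node_six hc.symm
  obtain ⟨w, hw, hwf⟩ := hf f l hxf hl
  obtain ⟨n, w, rfl, hxn, hxw⟩ := listTree_eq_node.1 (hw.symm.trans hn.2.2)
  obtain ⟨n, rfl, -, -⟩ := numTree_eq_node.1 (hxn.symm.trans hn.2.1)
  obtain ⟨w', hw', h_mem⟩ := hfix _ w hc' hxw
  refine ⟨w', hw', ?_⟩
  rw [Code.fix_eval] at h_mem ⊢
  exact PFun.mem_fix_iff.2 (Or.inr ⟨w, Part.mem_map _ hwf, h_mem⟩)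

theorem isRule_sound (m j : ℕ) : RuleSound m (isRule j) := by
  intro v hn hz hp
  cases j with
  | zero => exact hz 0 (by simp [isRule, HornRule.zeros])
  | succ j =>
    simp only [isRule, HornRule.nodes, HornRule.prems, HornRule.concl, EvalSem,
      List.forall_mem_cons] at hn hp ⊢
    rw [hn.1, hp.1, hp.2.1, node, Nat.pair_unpair]

theorem goalRule_sound (m : ℕ) : RuleSound m (goalRule m) := by
  intro v hn hz hp
  simp only [goalRule, HornRule.nodes, HornRule.prems, HornRule.concl, evalPrem, tagPrem, EvalSem,
    List.forall_mem_cons] at hn hp ⊢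
  refine ⟨v 0, v 1, hp.2.1.symm.trans hn.1, fun c l hc hl => ?_⟩
  obtain ⟨w, -, hw⟩ := hp.1 c l hc hl
  exact Part.dom_iff_mem.2 ⟨w, hw⟩

theorem evalRules_sound (m : ℕ) : ∀ r ∈ evalRules, RuleSound m r := by
  simp only [evalRules, List.forall_mem_cons]
  exact ⟨zeroRule_sound m, succNilRule_sound m, succConsRule_sound m, tailNilRule_sound m,
    tailConsRule_sound m, consNilRule_sound m, consConsRule_sound m, compRule_sound m,
    caseNilRule_sound m, caseZeroRule_sound m, caseSuccRule_sound m, fixNilRule_sound m,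
    fixZeroRule_sound m, fixSuccRule_sound m, by simp⟩

theorem evalSem_of_derives {m k x y z : ℕ} (h : Derives (evalProgram m) k x y z) :
    EvalSem m k x y z := by
  induction h with
  | app r hr v hn hz _ ih =>
    have hr' : RuleSound m r := by
      simp only [evalProgram, List.mem_append, List.mem_map, List.mem_singleton] at hr
      rcases hr with hr | ⟨j, -, rfl⟩ | rfl
      · exact evalRules_sound m r hr
      · exact isRule_sound m j
      · exact goalRule_sound m
    exact hr' v hn hz ih

theorem exists_derives_goal_iff {c : Code} {l : List ℕ} :
    (∃ x y z, Derives (evalProgram (node (codeTree c) (listTree l))) 1 x y z) ↔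
      (c.eval l).Dom := by
  constructor
  · rintro ⟨x, y, z, h⟩
    obtain ⟨a, b, hab, hdom⟩ := evalSem_of_derives h
    obtain ⟨rfl, rfl⟩ := node_inj.1 hab
    exact hdom c l rfl rfl
  · intro h
    obtain ⟨w, hw⟩ := Part.dom_iff_mem.1 h
    exact derives_goal hw

theorem homTrivial_evalProgram_iff {c : Code} {l : List ℕ} :
    HomTrivial (programTGDs (evalProgram (node (codeTree c) (listTree l))))
      { s | s ∈ dataSchema } { s | s ∈ querySchema } ↔ ¬ (c.eval l).Dom := by
  rw [← exists_derives_goal_iff]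
  constructor
  · rintro h ⟨x, y, z, hd⟩
    exact not_homTrivial_of_derives hd h
  · intro h
    exact homTrivial_of_not_derives fun x y z hd => h ⟨x, y, z, hd⟩

end Evaluation


/-! ### The reduction from the halting problem is computable -/

theorem primrec_relSym_mk : Primrec₂ RelSym.mk :=
  (Primrec.of_equiv_symm (e := relSymEquiv) : Primrec relSymEquiv.symm)

theorem primrec_atom_mk : Primrec₂ Atom.mk :=
  (Primrec.of_equiv_symm (e := atomEquiv) : Primrec atomEquiv.symm)

theorem primrec_tgd_mk :
    Primrec fun p : List Atom × List Atom × List ℕ => (⟨p.1, p.2.1, p.2.2⟩ : TGD) :=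
  (Primrec.of_equiv_symm (e := tgdEquiv) : Primrec tgdEquiv.symm)

theorem primrec_predAtom : Primrec predAtom := by
  have h : Primrec fun p : RVar × RVar × RVar =>
      [0, 1, 2, 3, RVar.toVar p.1, RVar.toVar p.2.1, RVar.toVar p.2.2] := Primrec.dom_finite _
  exact primrec_atom_mk.comp
    (primrec_relSym_mk.comp (Primrec.nat_add.comp (Primrec.const 6) Primrec.fst)
      (Primrec.const 7)) (h.comp Primrec.snd)

theorem primrec_ruleBody : Primrec ruleBody := by
  have hn : Primrec nodeAtoms := Primrec.dom_finite _
  have hl : Primrec leafAtoms := Primrec.dom_finite _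
  have hp : Primrec fun r : HornRule => r.prems.map predAtom :=
    Primrec.list_map (Primrec.fst.comp (Primrec.snd.comp Primrec.snd))
      (primrec_predAtom.comp Primrec.snd).to₂
  have hz : Primrec fun r : HornRule => r.zeros.flatMap leafAtoms :=
    Primrec.list_flatMap (Primrec.fst.comp Primrec.snd) (hl.comp Primrec.snd).to₂
  have hn' : Primrec fun r : HornRule => r.nodes.flatMap nodeAtoms :=
    Primrec.list_flatMap Primrec.fst (hn.comp Primrec.snd).to₂
  exact Primrec.list_append.comp (Primrec.const _)
    (Primrec.list_append.comp hn' (Primrec.list_append.comp hz hp))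

theorem primrec_ruleTGD : Primrec ruleTGD :=
  primrec_tgd_mk.comp <| Primrec.pair
    (Primrec.list_cons.comp (Primrec.const guardAtom) primrec_ruleBody)
    (Primrec.pair (Primrec.list_cons.comp (primrec_predAtom.comp
        (Primrec.snd.comp (Primrec.snd.comp Primrec.snd))) (Primrec.const []))
      (Primrec.const (List.range 16)))

theorem primrec_programTGDs : Primrec programTGDs :=
  Primrec.list_append.comp (Primrec.const baseTGDs)
    (Primrec.list_map Primrec.id (primrec_ruleTGD.comp Primrec.snd).to₂)

theorem primrec_predAtom_const (a b c : RVar) {f : ℕ → ℕ} (hf : Primrec f) :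
    Primrec fun m => ((f m, a, b, c) : PredAtom) :=
  Primrec.pair hf (Primrec.const _)

theorem primrec_isRule : Primrec isRule := by
  have h₁ : Primrec fun j : ℕ => j.unpair.1 + 2 :=
    Primrec.nat_add.comp (Primrec.fst.comp Primrec.unpair) (Primrec.const 2)
  have h₂ : Primrec fun j : ℕ => j.unpair.2 + 2 :=
    Primrec.nat_add.comp (Primrec.snd.comp Primrec.unpair) (Primrec.const 2)
  have h₃ : Primrec fun j : ℕ => j + 3 := Primrec.nat_add.comp Primrec.id (Primrec.const 3)
  have h : Primrec fun j : ℕ => isRule (j + 1) :=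
    Primrec.pair (Primrec.const _) (Primrec.pair (Primrec.const _) (Primrec.pair
      (Primrec.list_cons.comp (primrec_predAtom_const 1 1 1 h₁)
        (Primrec.list_cons.comp (primrec_predAtom_const 2 2 2 h₂) (Primrec.const [])))
      (primrec_predAtom_const 0 0 0 h₃)))
  exact (Primrec.nat_casesOn Primrec.id (Primrec.const (isRule 0)) (h.comp Primrec.snd).to₂).of_eq
    fun n => by cases n <;> rfl

theorem primrec_goalRule : Primrec goalRule :=
  Primrec.pair (Primrec.const _) (Primrec.pair (Primrec.const _) (Primrec.pair
    (Primrec.list_cons.comp (Primrec.const (evalPrem 0 1 2)) (Primrec.list_cons.comp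
      (primrec_predAtom_const 3 3 3 (Primrec.nat_add.comp Primrec.id (Primrec.const 2)))
      (Primrec.const []))) (Primrec.const _)))

theorem primrec_evalProgram : Primrec evalProgram :=
  Primrec.list_append.comp (Primrec.const evalRules) (Primrec.list_append.comp
    (Primrec.list_map (Primrec.list_range.comp
      (Primrec.nat_add.comp Primrec.id (Primrec.const 10))) (primrec_isRule.comp Primrec.snd).to₂)
    (Primrec.list_cons.comp primrec_goalRule (Primrec.const [])))

theorem primrec_node : Primrec₂ node := Primrec.succ.comp Primrec₂.natPair

theorem primrec_numTree : Primrec numTree :=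
  (Primrec.nat_rec₁ (f := fun _ t => node 0 t) 0
    (primrec_node.comp (Primrec.const 0) Primrec.snd)).of_eq fun n => by
    induction n with
    | zero => rfl
    | succ n ih => exact congrArg (node 0) ih

theorem exists_universal_code : ∃ c : Turing.ToPartrec.Code, ∀ d : Nat.Partrec.Code,
    (c.eval [Encodable.encode d]).Dom ↔ (d.eval 0).Dom := by
  have h : Partrec fun n : ℕ => (Denumerable.ofNat Nat.Partrec.Code n).eval 0 :=
    Nat.Partrec.Code.eval_part.comp (Computable.ofNat _) (Computable.const 0)
  obtain ⟨c, hc⟩ := Turing.ToPartrec.Code.exists_code (Nat.Partrec'.part_iff₁.2 h)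
  refine ⟨c, fun d => ?_⟩
  have hd := hc (Encodable.encode d ::ᵥ List.Vector.nil)
  rw [List.Vector.head_cons, Denumerable.ofNat_encode] at hd
  exact (congrArg Part.Dom hd).to_iff

/-- Theorem 1(3): triviality for guarded TGDs is undecidable. -/
theorem triviality_guarded_undecidable :
    ¬ ComputablePred (fun x : List TGD × List RelSym × List RelSym =>
        (∀ t ∈ x.1, t.wf ∧ t.Guarded) ∧
        HomTrivial x.1 { r | r ∈ x.2.1 } { r | r ∈ x.2.2 }) := by
  intro h
  obtain ⟨c, hc⟩ := exists_universal_code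
  let F : Nat.Partrec.Code → List TGD × List RelSym × List RelSym := fun d =>
    (programTGDs (evalProgram (node (codeTree c) (listTree [Encodable.encode d]))),
      dataSchema, querySchema)
  have hF : Primrec F :=
    Primrec.pair (primrec_programTGDs.comp (primrec_evalProgram.comp (primrec_node.comp
      (Primrec.const _) (primrec_node.comp (primrec_numTree.comp Primrec.encode)
        (Primrec.const 0))))) (Primrec.const _)
  refine ComputablePred.halting_problem 0
    (((ComputablePred.computable_of_manyOneReducible ⟨F, hF.to_comp, fun d => ?_⟩ h).not).of_eq
      fun d => not_not)
  rw [← hc d, ← homTrivial_evalProgram_iff]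
  exact ⟨fun hd => ⟨programTGDs_wf_guarded _, hd⟩, fun hd => hd.2⟩
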